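/- arXiv:2605.04889 — 2 statements merged into one kernel-verified Lean document; each statement's English description precedes it below -/
import Mathlib

section
/- Let k and a be integers with 1 ≤ a ≤ k. For a nonnegative integer n, let B_{k,a}(n) denote the number of partitions λ of n such that f_1(λ) ≤ a−1 and f_i(λ)+f_{i+1}(λ) ≤ k−1 for every i ≥ 1, and let A_{k,a}(n) denote the number of partitions of n none of whose parts is congruent to 0, a, or −a modulo 2k+1. Then A_{k,a}(n) = B_{k,a}(n) for all n ≥ 0. -/
open Finset

namespace RogersRamanujanGordon

section Ring

variable {R : Type*} [CommRing R]

/-- The finite product `(1 - q)(1 - q²)⋯(1 - qⁿ)`. -/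
def eulerProd (q : R) (n : ℕ) : R := ∏ j ∈ range n, (1 - q ^ (j + 1))

theorem eulerProd_succ (q : R) (n : ℕ) :
    eulerProd q (n + 1) = eulerProd q n * (1 - q ^ (n + 1)) :=
  prod_range_succ _ _

theorem pow_dvd_eulerProd_sub (q : R) (n r : ℕ) :
    q ^ (n + 1) ∣ eulerProd q (n + r) - eulerProd q n := by
  induction r with
  | zero => simp
  | succ r ih =>
    rw [← add_assoc, eulerProd_succ]
    have h : q ^ (n + 1) ∣ q ^ (n + r + 1) := pow_dvd_pow q (by omega)
    have e : eulerProd q (n + r) * (1 - q ^ (n + r + 1)) - eulerProd q n =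
        (eulerProd q (n + r) - eulerProd q n) - eulerProd q (n + r) * q ^ (n + r + 1) := by ring
    rw [e]
    exact dvd_sub ih (h.mul_left _)

theorem isCoprime_eulerProd_right (q : R) (n r : ℕ) : IsCoprime (q ^ r) (eulerProd q n) := by
  refine IsCoprime.pow_left (IsCoprime.prod_right fun j _ ↦ ?_)
  exact ⟨q ^ j, 1, by ring⟩

/-- The Gaussian binomial coefficient, defined by its Pascal-type recurrence. -/
def gaussBinom (q : R) : ℕ → ℕ → R
  | _, 0 => 1
  | 0, _ + 1 => 0
  | n + 1, j + 1 => gaussBinom q n (j + 1) + q ^ (n - j) * gaussBinom q n j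

theorem gaussBinom_zero_right (q : R) (n : ℕ) : gaussBinom q n 0 = 1 := by
  cases n <;> rfl

theorem gaussBinom_succ_succ (q : R) (n j : ℕ) :
    gaussBinom q (n + 1) (j + 1) =
      gaussBinom q n (j + 1) + q ^ (n - j) * gaussBinom q n j := rfl

theorem gaussBinom_eq_zero_of_lt (q : R) {n j : ℕ} (h : n < j) : gaussBinom q n j = 0 := by
  induction n generalizing j with
  | zero => obtain ⟨j, rfl⟩ := Nat.exists_eq_succ_of_ne_zero (by omega : j ≠ 0); rfl
  | succ n ih =>
    obtain ⟨j, rfl⟩ := Nat.exists_eq_succ_of_ne_zero (by omega : j ≠ 0)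
    rw [Nat.succ_eq_add_one, gaussBinom_succ_succ, ih (by omega), ih (by omega)]
    ring

theorem gaussBinom_self (q : R) (n : ℕ) : gaussBinom q n n = 1 := by
  induction n with
  | zero => rfl
  | succ n ih => rw [gaussBinom_succ_succ, gaussBinom_eq_zero_of_lt q (by omega), ih]; simp

/-- The factorial formula for Gaussian binomial coefficients. -/
theorem gaussBinom_mul_eulerProd (q : R) (i j : ℕ) :
    gaussBinom q (i + j) j * eulerProd q i * eulerProd q j = eulerProd q (i + j) := by
  induction i generalizing j with
  | zero => simp [gaussBinom_self, eulerProd]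
  | succ i ihi =>
    induction j with
    | zero => simp [gaussBinom_zero_right, eulerProd]
    | succ j ihj =>
      have h1 := ihi (j + 1)
      have e : i + 1 + (j + 1) = (i + (j + 1)) + 1 := by omega
      have e' : i + 1 + j = i + (j + 1) := by omega
      rw [e, gaussBinom_succ_succ, eulerProd_succ q (i + (j + 1))]
      rw [e'] at ihj
      have e2 : i + (j + 1) - j = i + 1 := by omega
      rw [e2]
      rw [eulerProd_succ] at ihj h1 ⊢
      rw [eulerProd_succ]
      linear_combination (1 - q ^ (i + 1)) * h1 + q ^ (i + 1) * (1 - q ^ (j + 1)) * ihj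

/-- Modulo a power of `q`, every Gaussian binomial coefficient is the inverse of an
Euler product. -/
theorem pow_dvd_gaussBinom_mul_eulerProd_sub_one (q : R) {i j m r : ℕ} (hi : r ≤ i) (hj : r ≤ j)
    (hm : r ≤ m) : q ^ (r + 1) ∣ gaussBinom q (i + j) j * eulerProd q m - 1 := by
  have key : ∀ n, r ≤ n → q ^ (r + 1) ∣ eulerProd q n - eulerProd q r := fun n hn ↦ by
    obtain ⟨s, rfl⟩ := Nat.exists_eq_add_of_le hn
    exact pow_dvd_eulerProd_sub q r s
  have h := gaussBinom_mul_eulerProd q i j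
  obtain ⟨u, hu⟩ := key i hi
  obtain ⟨v, hv⟩ := key j hj
  obtain ⟨w, hw⟩ := key m hm
  obtain ⟨t, ht⟩ := key (i + j) (by omega)
  refine (isCoprime_eulerProd_right q r (r + 1)).dvd_of_dvd_mul_right ?_
  refine ⟨gaussBinom q (i + j) j * eulerProd q r * w -
    gaussBinom q (i + j) j * (u * eulerProd q j + eulerProd q r * v) + t, ?_⟩
  linear_combination gaussBinom q (i + j) j * eulerProd q r * hw
    - gaussBinom q (i + j) j * eulerProd q j * hu - gaussBinom q (i + j) j * eulerProd q r * hv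
    + ht + h

/-- The `q`-binomial theorem, in homogeneous form. -/
theorem prod_add_mul_pow (q y z : R) (N : ℕ) :
    ∏ j ∈ range N, (y + z * q ^ j) =
      ∑ j ∈ range (N + 1), q ^ j.choose 2 * gaussBinom q N j * z ^ j * y ^ (N - j) := by
  induction N with
  | zero => simp [gaussBinom_zero_right]
  | succ N ih =>
    have hsum := sum_range_succ
      (fun j ↦ q ^ j.choose 2 * gaussBinom q N j * z ^ j * y ^ (N - j)) (N + 1)
    rw [gaussBinom_eq_zero_of_lt q (Nat.lt_succ_self N), sum_range_succ'] at hsum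
    rw [prod_range_succ, ih, sum_range_succ' _ (N + 1)]
    have hterm : ∀ j ∈ range (N + 1),
        q ^ (j + 1).choose 2 * gaussBinom q (N + 1) (j + 1) * z ^ (j + 1) * y ^ (N + 1 - (j + 1)) =
        y * (q ^ (j + 1).choose 2 * gaussBinom q N (j + 1) * z ^ (j + 1) * y ^ (N - (j + 1))) +
        z * q ^ N * (q ^ j.choose 2 * gaussBinom q N j * z ^ j * y ^ (N - j)) := by
      intro j hj
      have hj : j ≤ N := by simpa [Nat.lt_succ_iff] using hj
      obtain ⟨c, rfl⟩ := Nat.exists_eq_add_of_le hj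
      have hc : (j + 1).choose 2 = j + j.choose 2 := by
        rw [Nat.choose_succ_succ' j 1, Nat.choose_one_right]
      rw [gaussBinom_succ_succ, hc, Nat.add_sub_add_right, Nat.add_sub_cancel_left]
      rcases c with _ | c
      · rw [gaussBinom_eq_zero_of_lt q (by omega : j + 0 < j + 1)]
        simp
        ring
      · have e : j + (c + 1) - (j + 1) = c := by omega
        rw [e]
        ring
    rw [sum_congr rfl hterm, sum_add_distrib, ← mul_sum, ← mul_sum]
    simp only [gaussBinom_zero_right, Nat.choose_zero_succ, pow_zero, Nat.sub_zero, mul_one,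
      one_mul] at hsum ⊢
    linear_combination (-y) * hsum

theorem two_mul_choose_two_add (n : ℕ) : 2 * n.choose 2 + n = n * n := by
  induction n with
  | zero => rfl
  | succ n ih =>
    rw [Nat.choose_succ_succ' n 1, Nat.choose_one_right]
    nlinarith

theorem le_choose_two_succ (n : ℕ) : n ≤ (n + 1).choose 2 := by
  rw [Nat.choose_succ_succ' n 1, Nat.choose_one_right]
  omega

/-- The shifted product `(1 - xⁿ⁺¹)⋯(1 - xⁿ⁺ᴺ)`. -/
def shiftedProd (x : R) (N n : ℕ) : R := ∏ j ∈ range N, (1 - x ^ (n + j + 1))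

theorem shiftedProd_succ (x : R) (N n : ℕ) :
    shiftedProd x (N + 1) n = shiftedProd x N n * (1 - x ^ (n + N + 1)) :=
  prod_range_succ _ _

theorem shiftedProd_succ' (x : R) (N n : ℕ) :
    shiftedProd x (N + 1) n = (1 - x ^ (n + 1)) * shiftedProd x N (n + 1) := by
  rw [shiftedProd, prod_range_succ', mul_comm, shiftedProd]
  congr 1
  refine prod_congr rfl fun j _ ↦ ?_
  rw [show n + (j + 1) + 1 = n + 1 + j + 1 by omega]

/-- The `n`-th term of the numerator of Andrews' series `J_{k,i}`, evaluated at `x ^ N`. -/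
def gordonTerm (x : R) (k N i n : ℕ) : R :=
  (-1) ^ n * x ^ (N * k * n + (n + 1).choose 2 + k * n ^ 2 + (k - i) * n) *
    (1 - x ^ (N * i + (2 * n + 1) * i)) * shiftedProd x N n

/-- The truncated numerator of Andrews' series `J_{k,i}`, evaluated at `x ^ N`. -/
def gordonSum (x : R) (m k N i : ℕ) : R := ∑ n ∈ range m, gordonTerm x k N i n

theorem gordonSum_zero (x : R) (m k N : ℕ) : gordonSum x m k N 0 = 0 :=
  sum_eq_zero fun n _ ↦ by simp [gordonTerm]

/-- The `q`-difference equation of Andrews' series. -/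
theorem gordonSum_succ {x : R} {m : ℕ} (hx : x ^ m = 0) {k i : ℕ} (hi : i < k) (N : ℕ) :
    gordonSum x m k N (i + 1) =
      gordonSum x m k N i + x ^ ((N + 1) * i) * gordonSum x m k (N + 1) (k - i) := by
  obtain ⟨c, rfl⟩ := Nat.exists_eq_add_of_le (Nat.succ_le_of_lt hi)
  set k := i.succ + c with hk
  let U : ℕ → R := fun n ↦ (-1) ^ n * x ^ (N * k * n + (n + 1).choose 2 + k * n ^ 2 + c * n) *
    (1 - x ^ n) * shiftedProd x N n
  have hU0 : U 0 = 0 := by simp [U]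
  have hUm : U m = 0 := by
    have : x ^ (N * k * m + (m + 1).choose 2 + k * m ^ 2 + c * m) = 0 :=
      pow_eq_zero_of_le (by have := le_choose_two_succ m; omega) hx
    simp [U, this]
  have hshift : ∑ n ∈ range m, U (n + 1) = ∑ n ∈ range m, U n := by
    have h1 := sum_range_succ U m
    rw [sum_range_succ', hU0, hUm] at h1
    simpa using h1
  have hterm : ∀ n, gordonTerm x k N (i + 1) n - gordonTerm x k N i n =
      U n - U (n + 1) + x ^ ((N + 1) * i) * gordonTerm x k (N + 1) (k - i) n := by
    intro n
    have e1 : k - (i + 1) = c := by omega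
    have e2 : k - i = c + 1 := by omega
    have e3 : k - (c + 1) = i := by omega
    have hc : (n + 1 + 1).choose 2 = n + 1 + (n + 1).choose 2 := by
      rw [Nat.choose_succ_succ' (n + 1) 1, Nat.choose_one_right]
    simp only [gordonTerm, U, e1, e2, e3, hc]
    have hs := (shiftedProd_succ' x N n).symm
    rw [shiftedProd_succ] at hs ⊢
    have hk' : k = i + 1 + c := rfl
    rw [hk']
    linear_combination (-1) ^ (n + 1) * x ^ (N * (i + 1 + c) * (n + 1) +
      (n + 1 + (n + 1).choose 2) + (i + 1 + c) * (n + 1) ^ 2 + c * (n + 1)) * hs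
  have := sum_congr rfl fun n (_ : n ∈ range m) ↦ hterm n
  rw [sum_sub_distrib, sum_add_distrib, sum_sub_distrib, hshift, ← mul_sum] at this
  simp only [gordonSum]
  linear_combination this

theorem gordonSum_eq_eulerProd {x : R} {m : ℕ} (hm : 0 < m) (hx : x ^ m = 0) {k N i : ℕ}
    (hk : 0 < k) (hN : m ≤ N) (hi : 0 < i) : gordonSum x m k N i = eulerProd x m := by
  have hN' : eulerProd x N = eulerProd x m := by
    obtain ⟨r, rfl⟩ := Nat.exists_eq_add_of_le hN
    have h := pow_dvd_eulerProd_sub x m r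
    rw [pow_eq_zero_of_le (Nat.le_succ m) hx, zero_dvd_iff] at h
    exact sub_eq_zero.mp h
  rw [gordonSum, sum_eq_single_of_mem 0 (by simpa using hm), ← hN']
  · have : x ^ (N * i + i) = 0 := pow_eq_zero_of_le (by nlinarith) hx
    simp [gordonTerm, this, shiftedProd, eulerProd]
  · intro n _ hn
    have h1 : N ≤ N * k * n := by
      rw [mul_assoc]
      exact Nat.le_mul_of_pos_right _ (Nat.mul_pos hk (Nat.pos_of_ne_zero hn))
    have : x ^ (N * k * n + (n + 1).choose 2 + k * n ^ 2 + (k - i) * n) = 0 :=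
      pow_eq_zero_of_le (by omega) hx
    simp [gordonTerm, this]

/-- A family satisfying the `q`-difference equation of Andrews' series, and the same limit
condition, is the corresponding multiple of Andrews' series. -/
theorem eulerProd_mul_eq_gordonSum {x : R} {m : ℕ} (hm : 0 < m) (hx : x ^ m = 0) {k : ℕ}
    (hk : 0 < k) (B : ℕ → ℕ → R) (hB0 : ∀ N, B N 0 = 0)
    (hB : ∀ N i, i < k → B N (i + 1) = B N i + x ^ ((N + 1) * i) * B (N + 1) (k - i))
    (hBlim : ∀ N i, m ≤ N → 0 < i → B N i = 1) (N i : ℕ) (hi : i ≤ k) :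
    eulerProd x m * B N i = gordonSum x m k N i := by
  have key : ∀ d N, m ≤ N + d → ∀ i ≤ k, eulerProd x m * B N i = gordonSum x m k N i := by
    intro d
    induction d with
    | zero =>
      intro N hN i _
      rw [add_zero] at hN
      rcases Nat.eq_zero_or_pos i with rfl | hpos
      · rw [hB0, gordonSum_zero, mul_zero]
      · rw [hBlim N i hN hpos, gordonSum_eq_eulerProd hm hx hk hN hpos, mul_one]
    | succ d ihd =>
      intro N hN i
      induction i with
      | zero => intro _; rw [hB0, gordonSum_zero, mul_zero]
      | succ i ihi =>
        intro hi
        rw [hB N i hi, gordonSum_succ hx hi, ← ihi (by omega),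
          ← ihd (N + 1) (by omega) (k - i) (by omega)]
        ring
  exact key m N (by omega) i hi

end Ring

open PowerSeries

theorem sum_range_add_mul (a K m : ℕ) :
    ∑ j ∈ range m, (a + K * j) = a * m + K * m.choose 2 := by
  induction m with
  | zero => simp
  | succ m ih =>
    rw [sum_range_succ, ih, Nat.choose_succ_succ' m 1, Nat.choose_one_right]
    ring

/-- The finite form of the Jacobi triple product identity in the base `X ^ (2k + 1)`, at `X ^ a`. -/
theorem finite_jacobi_triple_product {k a : ℕ} (hak : a ≤ k) (m : ℕ) :
    (∏ j ∈ range m, (1 - (X : ℤ⟦X⟧) ^ ((2 * k + 1) * (j + 1) - a))) *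
        ∏ j ∈ range m, (1 - (X : ℤ⟦X⟧) ^ (a + (2 * k + 1) * j)) =
      ∑ n ∈ range (m + 1), (-1) ^ n * X ^ ((n + 1).choose 2 + k * n ^ 2 + (k - a) * n) *
          gaussBinom (X ^ (2 * k + 1)) (2 * m) (m - n) +
      ∑ n ∈ range m, (-1) ^ (n + 1) * X ^ ((2 * k + 1) * (n + 1).choose 2 + a * (n + 1)) *
          gaussBinom (X ^ (2 * k + 1)) (2 * m) (m + 1 + n) := by
  set K := 2 * k + 1 with hK
  set C := a * m + K * m.choose 2 + K * m * m with hC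
  have hleft : ∏ j ∈ range m, ((X : ℤ⟦X⟧) ^ (K * m) + -X ^ a * (X ^ K) ^ j) =
      (-1) ^ m * X ^ (a * m + K * m.choose 2) * ∏ j ∈ range m, (1 - X ^ (K * (j + 1) - a)) := by
    rw [← sum_range_add_mul, ← sum_range_reflect, ← prod_pow_eq_pow_sum, ← prod_range_reflect]
    conv_rhs => rw [← card_range m, ← prod_const, card_range]
    rw [← prod_mul_distrib, ← prod_mul_distrib]
    refine prod_congr rfl fun j hj ↦ ?_
    have hj : j < m := by simpa using hj
    have e : (X : ℤ⟦X⟧) ^ (K * m) = X ^ (a + K * (m - 1 - j)) * X ^ (K * (j + 1) - a) := by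
      rw [← pow_add]
      congr 1
      obtain ⟨c, rfl⟩ := Nat.exists_eq_add_of_lt hj
      have h1 : j + c + 1 - 1 - j = c := by omega
      have h2 : a ≤ K * (j + 1) := by nlinarith
      have h3 : K * (j + c + 1) = K * c + K * (j + 1) := by ring
      rw [h1, h3]
      omega
    rw [e, ← pow_mul, pow_add]
    ring
  have hright : ∏ j ∈ range m, ((X : ℤ⟦X⟧) ^ (K * m) + -X ^ a * (X ^ K) ^ (m + j)) =
      X ^ (K * m * m) * ∏ j ∈ range m, (1 - X ^ (a + K * j)) := by
    rw [pow_mul X (K * m) m]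
    conv_rhs => rw [← card_range m, ← prod_const, card_range]
    rw [← prod_mul_distrib]
    refine prod_congr rfl fun j _ ↦ ?_
    ring
  have hbinom := prod_add_mul_pow ((X : ℤ⟦X⟧) ^ K) (X ^ (K * m)) (-X ^ a) (m + m)
  rw [prod_range_add, hleft, hright, show m + m + 1 = (m + 1) + m by omega, sum_range_add,
    ← sum_range_reflect, ← two_mul] at hbinom
  have hne : ((-1) ^ m * X ^ C : ℤ⟦X⟧) ≠ 0 :=
    mul_ne_zero (pow_ne_zero _ (by simp)) (pow_ne_zero _ X_ne_zero)
  apply mul_left_cancel₀ hne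
  rw [mul_add, mul_sum, mul_sum]
  convert hbinom using 1
  · rw [hC, pow_add]
    ring
  congr 1
  · refine sum_congr rfl fun n hn ↦ ?_
    have hn : n ≤ m := by simpa [Nat.lt_succ_iff] using hn
    obtain ⟨i, rfl⟩ := Nat.exists_eq_add_of_le' hn
    obtain ⟨c, rfl⟩ := Nat.exists_eq_add_of_le hak
    have e1 : i + n + 1 - 1 - n = i := by omega
    have e2 : i + n - n = i := by omega
    have e3 : 2 * (i + n) - i = i + 2 * n := by omega
    have e4 : a + c - a = c := by omega
    have hexp : C + ((n + 1).choose 2 + (a + c) * n ^ 2 + c * n) =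
        K * i.choose 2 + a * i + K * (i + n) * (i + 2 * n) := by
      have h1 := two_mul_choose_two_add (n + 1)
      have h2 := two_mul_choose_two_add i
      have h3 := two_mul_choose_two_add (i + n)
      rw [hC, hK]
      zify at h1 h2 h3 ⊢
      apply mul_left_cancel₀ (two_ne_zero (α := ℤ))
      linear_combination h1 + (2 * (a + c) + 1) * h3 - (2 * (a + c) + 1) * h2
    have hsign : ((-1) ^ (i + n) * (-1) ^ n : ℤ⟦X⟧) = (-1) ^ i := by
      rw [pow_add, mul_assoc, ← mul_pow]
      simp
    rw [e1, e2, e3, e4, neg_pow (X ^ a : ℤ⟦X⟧), ← hsign]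
    have hX := congrArg (fun e ↦ (X : ℤ⟦X⟧) ^ e) hexp
    simp only [pow_add _ C, pow_add _ _ (K * (i + n) * (i + 2 * n)), pow_add _ (K * i.choose 2),
      pow_mul _ K (i.choose 2), pow_mul _ a i, pow_mul _ (K * (i + n)) (i + 2 * n)] at hX
    linear_combination (-1) ^ (i + n) * (-1) ^ n * gaussBinom (X ^ K) (2 * (i + n)) i * hX
  · refine sum_congr rfl fun n hn ↦ ?_
    have hn : n < m := by simpa using hn
    obtain ⟨i, rfl⟩ := Nat.exists_eq_add_of_lt hn
    set M := n + i + 1 with hM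
    have e3 : 2 * M - (M + 1 + n) = i := by omega
    have hexp : C + (K * (n + 1).choose 2 + a * (n + 1)) =
        K * (M + 1 + n).choose 2 + a * (M + 1 + n) + K * M * i := by
      have h1 := two_mul_choose_two_add (n + 1)
      have h2 := two_mul_choose_two_add (M + 1 + n)
      have h3 := two_mul_choose_two_add M
      rw [hC]
      have hM' : (M : ℤ) = n + i + 1 := by rw [hM]; push_cast; ring
      zify at h1 h2 h3 ⊢
      apply mul_left_cancel₀ (two_ne_zero (α := ℤ))
      have hi : (i : ℤ) = M - n - 1 := by linarith
      rw [hi]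
      linear_combination (K : ℤ) * h1 + (K : ℤ) * h3 - (K : ℤ) * h2
    have hsign : ((-1) ^ M * (-1) ^ (n + 1) : ℤ⟦X⟧) = (-1) ^ (M + 1 + n) := by
      rw [← pow_add]
      congr 1
      omega
    rw [e3, neg_pow (X ^ a : ℤ⟦X⟧), ← hsign]
    have hX := congrArg (fun e ↦ (X : ℤ⟦X⟧) ^ e) hexp
    simp only [pow_add _ C, pow_add _ _ (K * M * i), pow_add _ (K * (M + 1 + n).choose 2),
      pow_mul _ K ((M + 1 + n).choose 2), pow_mul _ a (M + 1 + n), pow_mul _ (K * M) i] at hX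
    linear_combination (-1) ^ M * (-1) ^ (n + 1) * gaussBinom (X ^ K) (2 * M) (M + 1 + n) * hX

theorem gordonSum_zero_shift {R : Type*} [CommRing R] (x : R) {k a : ℕ} (hak : a ≤ k) (m : ℕ) :
    gordonSum x m k 0 a =
      ∑ n ∈ range m, (-1) ^ n * x ^ ((n + 1).choose 2 + k * n ^ 2 + (k - a) * n) +
      ∑ n ∈ range m, (-1) ^ (n + 1) * x ^ ((2 * k + 1) * (n + 1).choose 2 + a * (n + 1)) := by
  rw [gordonSum, ← sum_add_distrib]
  refine sum_congr rfl fun n _ ↦ ?_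
  obtain ⟨c, rfl⟩ := Nat.exists_eq_add_of_le hak
  have e4 : a + c - a = c := by omega
  have hexp : (2 * (a + c) + 1) * (n + 1).choose 2 + a * (n + 1) =
      ((n + 1).choose 2 + (a + c) * n ^ 2 + c * n) + (2 * n + 1) * a := by
    have h1 := two_mul_choose_two_add (n + 1)
    zify at h1 ⊢
    linear_combination (a + c : ℤ) * h1
  rw [hexp, e4, pow_add x _ ((2 * n + 1) * a)]
  simp only [gordonTerm, shiftedProd, e4, zero_mul, zero_add, prod_range_zero]
  ring

/-- The Jacobi triple product identity in the base `X ^ (2k + 1)`, at `X ^ a`, modulo `X ^ m`. -/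
theorem X_pow_dvd_tripleProd_sub_gordonSum {k a : ℕ} (hak : a ≤ k) (m : ℕ) :
    (X : ℤ⟦X⟧) ^ m ∣ eulerProd (X ^ (2 * k + 1)) m *
        ((∏ j ∈ range m, (1 - X ^ ((2 * k + 1) * (j + 1) - a))) *
          ∏ j ∈ range m, (1 - X ^ (a + (2 * k + 1) * j))) - gordonSum X m k 0 a := by
  have hterm : ∀ e i j r, r ≤ i → r ≤ j → r ≤ m → m ≤ e + (r + 1) → ∀ s : ℤ⟦X⟧,
      (X : ℤ⟦X⟧) ^ m ∣ eulerProd (X ^ (2 * k + 1)) m *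
        (s * X ^ e * gaussBinom (X ^ (2 * k + 1)) (i + j) j) - s * X ^ e := by
    intro e i j r hi hj hm he s
    have h := pow_dvd_gaussBinom_mul_eulerProd_sub_one ((X : ℤ⟦X⟧) ^ (2 * k + 1)) hi hj hm
    rw [← pow_mul] at h
    have h' : (X : ℤ⟦X⟧) ^ m ∣ X ^ e * X ^ ((2 * k + 1) * (r + 1)) := by
      rw [← pow_add]
      exact pow_dvd_pow _ (by nlinarith [Nat.zero_le (k * (r + 1))])
    have e' : eulerProd (X ^ (2 * k + 1)) m *
        (s * X ^ e * gaussBinom (X ^ (2 * k + 1)) (i + j) j) - s * X ^ e =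
        s * (X ^ e * (gaussBinom (X ^ (2 * k + 1)) (i + j) j *
          eulerProd (X ^ (2 * k + 1)) m - 1)) := by ring
    rw [e']
    exact (h'.trans (mul_dvd_mul_left _ h)).mul_left _
  rw [finite_jacobi_triple_product hak, gordonSum_zero_shift X hak]
  have hlast : (X : ℤ⟦X⟧) ^ m ∣
      (-1) ^ m * X ^ ((m + 1).choose 2 + k * m ^ 2 + (k - a) * m) :=
    (pow_dvd_pow _ (by have := le_choose_two_succ m; omega)).mul_left _
  have h1 : (X : ℤ⟦X⟧) ^ m ∣ ∑ n ∈ range (m + 1), (eulerProd (X ^ (2 * k + 1)) m *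
      ((-1) ^ n * X ^ ((n + 1).choose 2 + k * n ^ 2 + (k - a) * n) *
          gaussBinom (X ^ (2 * k + 1)) (2 * m) (m - n)) -
        (-1) ^ n * X ^ ((n + 1).choose 2 + k * n ^ 2 + (k - a) * n)) := by
    refine dvd_sum fun n hn ↦ ?_
    have hn : n ≤ m := by simpa [Nat.lt_succ_iff] using hn
    have := le_choose_two_succ n
    rw [show 2 * m = (m + n) + (m - n) by omega]
    exact hterm _ (m + n) (m - n) (m - n) (by omega) le_rfl (by omega) (by omega) _
  have h2 : (X : ℤ⟦X⟧) ^ m ∣ ∑ n ∈ range m, (eulerProd (X ^ (2 * k + 1)) m *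
      ((-1) ^ (n + 1) * X ^ ((2 * k + 1) * (n + 1).choose 2 + a * (n + 1)) *
          gaussBinom (X ^ (2 * k + 1)) (2 * m) (m + 1 + n)) -
        (-1) ^ (n + 1) * X ^ ((2 * k + 1) * (n + 1).choose 2 + a * (n + 1))) := by
    refine dvd_sum fun n hn ↦ ?_
    have hn : n < m := by simpa using hn
    have h3 := le_choose_two_succ n
    have h4 : (n + 1).choose 2 ≤ (2 * k + 1) * (n + 1).choose 2 :=
      Nat.le_mul_of_pos_left _ (by omega)
    rw [show 2 * m = (m - 1 - n) + (m + 1 + n) by omega]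
    exact hterm _ (m - 1 - n) (m + 1 + n) (m - 1 - n) le_rfl (by omega) (by omega) (by omega) _
  rw [sum_sub_distrib, ← mul_sum] at h1 h2
  rw [sum_range_succ (fun n ↦ (-1) ^ n * X ^ ((n + 1).choose 2 + k * n ^ 2 + (k - a) * n))] at h1
  have := dvd_add (dvd_add h1 hlast) h2
  convert this using 1
  ring

/-- The product of `1 - Xⁱ` over the `i ≤ (2k + 1) m` congruent to `0, ±a` modulo `2k + 1`. -/
theorem prod_residues_eq_tripleProd {k a : ℕ} (ha : 1 ≤ a) (hak : a ≤ k) (p : ℕ → Prop)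
    [DecidablePred p] (hp : ∀ i, p i ↔ i % (2 * k + 1) ≠ 0 ∧ i % (2 * k + 1) ≠ a ∧
      i % (2 * k + 1) ≠ 2 * k + 1 - a) (m : ℕ) :
    ∏ i ∈ range ((2 * k + 1) * m), (if p (i + 1) then 1 else 1 - (X : ℤ⟦X⟧) ^ (i + 1)) =
      eulerProd (X ^ (2 * k + 1)) m *
        ((∏ j ∈ range m, (1 - X ^ ((2 * k + 1) * (j + 1) - a))) *
          ∏ j ∈ range m, (1 - X ^ (a + (2 * k + 1) * j))) := by
  induction m with
  | zero => simp [eulerProd]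
  | succ m ih =>
    rw [mul_add_one, prod_range_add, ih, eulerProd_succ,
      prod_range_succ _ m, prod_range_succ _ m]
    have hblock : ∏ r ∈ range (2 * k + 1), (if p ((2 * k + 1) * m + r + 1) then 1 else
        1 - (X : ℤ⟦X⟧) ^ ((2 * k + 1) * m + r + 1)) =
        ∏ r ∈ {a - 1, 2 * k - a, 2 * k}, (1 - (X : ℤ⟦X⟧) ^ ((2 * k + 1) * m + r + 1)) := by
      symm
      rw [← prod_subset_one_on_sdiff (s₁ := {a - 1, 2 * k - a, 2 * k}) (g := fun r ↦
        (if p ((2 * k + 1) * m + r + 1) then 1 else 1 - (X : ℤ⟦X⟧) ^ ((2 * k + 1) * m + r + 1)))]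
      · intro r hr
        simp only [mem_insert, mem_singleton] at hr
        simp only [mem_range]
        omega
      · intro r hr
        simp only [mem_sdiff, mem_range, mem_insert, mem_singleton, not_or] at hr
        rw [if_pos]
        rw [hp, add_assoc, Nat.mul_add_mod]
        rcases Nat.lt_or_ge (r + 1) (2 * k + 1) with h | h
        · rw [Nat.mod_eq_of_lt h]
          omega
        · omega
      · intro r hr
        simp only [mem_insert, mem_singleton] at hr
        rw [if_neg]
        rw [hp, add_assoc, Nat.mul_add_mod]
        rcases hr with rfl | rfl | rfl
        · rw [Nat.mod_eq_of_lt (by omega)]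
          omega
        · rw [Nat.mod_eq_of_lt (by omega)]
          omega
        · simp
    have e1 : (2 * k + 1) * (m + 1) - a = (2 * k + 1) * m + (2 * k - a) + 1 := by
      rw [mul_add_one]
      omega
    have e2 : a + (2 * k + 1) * m = (2 * k + 1) * m + (a - 1) + 1 := by omega
    rw [hblock, prod_insert (by simp; omega), prod_insert (by simp; omega), prod_singleton, e1, e2]
    ring

section Restricted

open PowerSeries.WithPiTopology Nat.Partition

/-- Partitions with restricted parts are generated by the inverse of the product of `1 - Xⁱ`. -/
theorem X_pow_dvd_card_restricted_mul_prod_sub_one (p : ℕ → Prop) [DecidablePred p] (L : ℕ) :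
    (X : ℤ⟦X⟧) ^ L ∣ (PowerSeries.mk fun n ↦ (#(restricted n p) : ℤ)) *
      ∏ i ∈ range L, (if p (i + 1) then 1 - X ^ (i + 1) else 1) - 1 := by
  set g : ℕ → ℤ⟦X⟧ := fun i ↦ if p (i + 1) then 1 - X ^ (i + 1) else 1 with hg
  set f : ℕ → ℤ⟦X⟧ := fun i ↦ if p (i + 1) then ∑' j : ℕ, X ^ ((i + 1) * j) else 1 with hf
  have hfg : ∀ i, f i * g i = 1 := by
    intro i
    simp only [hf, hg]
    split_ifs
    · simp_rw [pow_mul]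
      exact tsum_pow_mul_one_sub_of_constantCoeff_eq_zero (by simp)
    · simp
  have hf1 : ∀ i, L ≤ i → X ^ L ∣ f i - 1 := by
    intro i hi
    have hgi : X ^ L ∣ 1 - g i := by
      simp only [hg]
      split_ifs
      · simpa using pow_dvd_pow (X : ℤ⟦X⟧) (by omega : L ≤ i + 1)
      · simp
    have : f i - 1 = f i * (1 - g i) := by rw [mul_sub, hfg, mul_one]
    exact this ▸ hgi.mul_left _
  have hprod : ∀ s : Finset ℕ, (∀ i ∈ s, L ≤ i) → X ^ L ∣ ∏ i ∈ s, f i - 1 := by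
    intro s
    induction s using Finset.induction_on with
    | empty => simp
    | insert i s his ih =>
      intro h
      rw [prod_insert his]
      have : f i * ∏ j ∈ s, f j - 1 = (f i - 1) * ∏ j ∈ s, f j + (∏ j ∈ s, f j - 1) := by ring
      rw [this]
      exact dvd_add ((hf1 i (h i (by simp))).mul_right _) (ih fun j hj ↦ h j (by simp [hj]))
  have hA := hasProd_powerSeriesMk_card_restricted ℤ p
  rw [HasProd, SummationFilter.unconditional_filter] at hA
  have hlim := hA.mul_const (∏ i ∈ range L, g i)
  rw [X_pow_dvd_iff]
  intro d hd
  rw [map_sub, sub_eq_zero]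
  have hlim' := (WithPiTopology.tendsto_iff_coeff_tendsto _ _ _ _).mp hlim d
  refine tendsto_nhds_unique hlim' (Filter.Tendsto.congr' ?_ tendsto_const_nhds)
  filter_upwards [Filter.eventually_ge_atTop (range L)] with s hs
  have e : (∏ i ∈ s, f i) * ∏ i ∈ range L, g i = ∏ i ∈ s \ range L, f i := by
    rw [← prod_sdiff hs, mul_assoc, ← prod_mul_distrib]
    simp [hfg]
  rw [e]
  have h := X_pow_dvd_iff.mp (hprod (s \ range L) (by simp)) d hd
  rw [map_sub, sub_eq_zero] at h
  exact h.symm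

end Restricted

section Gordon

/-- The partitions of `n` (as multisets) with all parts greater than `N`, fewer than `i` parts equal
to `N + 1`, and fewer than `k` parts in total equal to `j` or `j + 1`, for each `j > N`. -/
def gordonSet (k N i n : ℕ) : Set (Multiset ℕ) :=
  {s | s.sum = n ∧ (∀ p ∈ s, N < p) ∧ s.count (N + 1) < i ∧
    ∀ j, N < j → s.count j + s.count (j + 1) < k}

theorem finite_gordonSet (k N i n : ℕ) : (gordonSet k N i n).Finite := by
  refine (Set.finite_range (Nat.Partition.parts (n := n))).subset ?_
  rintro s ⟨hs, hpos, -⟩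
  exact ⟨⟨s, fun {p} hp ↦ Nat.zero_lt_of_lt (hpos p hp), hs⟩, rfl⟩

/-- The generating function of `gordonSet`. -/
noncomputable def gordonGenFun (k N i : ℕ) : ℤ⟦X⟧ :=
  PowerSeries.mk fun n ↦ ((gordonSet k N i n).ncard : ℤ)

theorem gordonGenFun_zero (k N : ℕ) : gordonGenFun k N 0 = 0 := by
  ext n
  simp [gordonGenFun, gordonSet]

theorem gordonSet_succ_diff {k i : ℕ} (hi : i < k) (N n : ℕ) :
    gordonSet k N (i + 1) ((N + 1) * i + n) \ gordonSet k N i ((N + 1) * i + n) =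
      (fun s ↦ s + Multiset.replicate i (N + 1)) '' gordonSet k (N + 1) (k - i) n := by
  ext s
  simp only [gordonSet, Set.mem_sdiff, Set.mem_ofPred_eq, Set.mem_image]
  constructor
  · rintro ⟨⟨hsum, hN, hc, hk⟩, hnot⟩
    have hci : s.count (N + 1) = i := by
      by_contra h
      exact hnot ⟨hsum, hN, by omega, hk⟩
    have hdecomp : s.filter (N + 1 ≠ ·) + Multiset.replicate i (N + 1) = s := by
      rw [← hci, ← Multiset.filter_eq, add_comm]
      exact Multiset.filter_add_not _ s
    have hcount : ∀ j, N + 1 < j → (s.filter (N + 1 ≠ ·)).count j = s.count j := fun j hj ↦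
      Multiset.count_filter_of_pos hj.ne
    refine ⟨s.filter (N + 1 ≠ ·), ⟨?_, ?_, ?_, ?_⟩, hdecomp⟩
    · have := congrArg Multiset.sum hdecomp
      rw [Multiset.sum_add, Multiset.sum_replicate, hsum, smul_eq_mul, mul_comm i] at this
      omega
    · intro p hp
      rw [Multiset.mem_filter] at hp
      have := hN p hp.1
      have := hp.2
      omega
    · rw [hcount _ (by omega)]
      have := hk (N + 1) (by omega)
      omega
    · intro j hj
      rw [hcount j hj, hcount (j + 1) (by omega)]
      exact hk j (by omega)
  · rintro ⟨t, ⟨hsum, hN, hc, hk⟩, rfl⟩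
    have ht : t.count (N + 1) = 0 :=
      Multiset.count_eq_zero.mpr fun h ↦ lt_irrefl _ (hN _ h)
    have hcount : (t + Multiset.replicate i (N + 1)).count (N + 1) = i := by
      rw [Multiset.count_add, ht, Multiset.count_replicate_self, zero_add]
    have hcount' : ∀ j, N + 1 < j →
        (t + Multiset.replicate i (N + 1)).count j = t.count j := fun j hj ↦ by
      rw [Multiset.count_add, Multiset.count_replicate, if_neg hj.ne, add_zero]
    refine ⟨⟨?_, ?_, ?_, ?_⟩, ?_⟩
    · rw [Multiset.sum_add, Multiset.sum_replicate, hsum, smul_eq_mul]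
      ring
    · intro p hp
      rcases Multiset.mem_add.mp hp with h | h
      · have := hN p h
        omega
      · rw [Multiset.eq_of_mem_replicate h]
        omega
    · omega
    · intro j hj
      rcases Nat.lt_or_ge (N + 1) j with h | h
      · rw [hcount' j h, hcount' (j + 1) (by omega)]
        exact hk j h
      · obtain rfl : j = N + 1 := by omega
        rw [hcount, hcount' (N + 1 + 1) (by omega)]
        omega
    · rintro ⟨-, -, h, -⟩
      omega

theorem gordonSet_succ_of_lt {N i n : ℕ} (hn : n < (N + 1) * i) (k : ℕ) :
    gordonSet k N (i + 1) n = gordonSet k N i n := by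
  ext s
  simp only [gordonSet, Set.mem_ofPred_eq]
  refine and_congr_right fun hsum ↦ and_congr_right fun _ ↦ and_congr_left fun _ ↦ ?_
  refine ⟨fun h ↦ lt_of_le_of_ne (Nat.lt_succ_iff.mp h) fun heq ↦ ?_, fun h ↦ by omega⟩
  have hle : Multiset.replicate i (N + 1) ≤ s := Multiset.le_count_iff_replicate_le.mp heq.ge
  obtain ⟨t, rfl⟩ := Multiset.le_iff_exists_add.mp hle
  rw [Multiset.sum_add, Multiset.sum_replicate, smul_eq_mul, mul_comm i] at hsum
  omega

theorem gordonGenFun_succ {k i : ℕ} (hi : i < k) (N : ℕ) :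
    gordonGenFun k N (i + 1) =
      gordonGenFun k N i + X ^ ((N + 1) * i) * gordonGenFun k (N + 1) (k - i) := by
  ext n
  rw [map_add, coeff_X_pow_mul']
  simp only [gordonGenFun, coeff_mk]
  split_ifs with h
  · obtain ⟨n, rfl⟩ := Nat.exists_eq_add_of_le h
    have hsub : gordonSet k N i ((N + 1) * i + n) ⊆ gordonSet k N (i + 1) ((N + 1) * i + n) :=
      fun s ⟨h1, h2, h3, h4⟩ ↦ ⟨h1, h2, by omega, h4⟩
    rw [← Set.ncard_sdiff_add_ncard_of_subset hsub (finite_gordonSet ..), gordonSet_succ_diff hi,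
      Set.ncard_image_of_injective _ (add_left_injective _), Nat.add_sub_cancel_left]
    push_cast
    ring
  · rw [gordonSet_succ_of_lt (by omega), add_zero]

theorem X_pow_dvd_gordonGenFun_sub_one {k i : ℕ} (hk : 0 < k) (hi : 0 < i) (N : ℕ) :
    X ^ (N + 1) ∣ gordonGenFun k N i - 1 := by
  rw [X_pow_dvd_iff]
  intro n hn
  rw [map_sub, coeff_one, gordonGenFun, coeff_mk, sub_eq_zero]
  split_ifs with h
  · subst h
    have : gordonSet k N i 0 = {0} := by
      ext s
      simp only [gordonSet, Set.mem_ofPred_eq, Set.mem_singleton_iff]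
      constructor
      · rintro ⟨hsum, hN, -⟩
        refine Multiset.eq_zero_of_forall_notMem fun p hp ↦ ?_
        have := hN p hp
        have := Multiset.le_sum_of_mem hp
        omega
      · rintro rfl
        simpa using ⟨hi, fun _ _ ↦ hk⟩
    rw [this, Set.ncard_singleton, Nat.cast_one]
  · have : gordonSet k N i n = ∅ := by
      refine Set.eq_empty_of_forall_notMem ?_
      rintro s ⟨hsum, hN, -⟩
      obtain rfl | hs := Multiset.empty_or_exists_mem s
      · exact h (by simpa using hsum.symm)
      · obtain ⟨p, hp⟩ := hs
        have := hN p hp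
        have := Multiset.le_sum_of_mem hp
        omega
    rw [this, Set.ncard_empty, Nat.cast_zero]

theorem natCard_partition_eq_ncard_gordonSet {k a : ℕ} (ha : 1 ≤ a) (hak : a ≤ k) (n : ℕ) :
    Nat.card {P : n.Partition // P.parts.count 1 ≤ a - 1 ∧
        ∀ i : ℕ, 1 ≤ i → P.parts.count i + P.parts.count (i + 1) ≤ k - 1} =
      (gordonSet k 0 a n).ncard := by
  rw [← Nat.card_coe_set_eq]
  refine Nat.card_congr
    { toFun := fun P ↦ ⟨P.1.parts, P.1.parts_sum, fun p hp ↦ P.1.parts_pos hp, ?_, ?_⟩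
      invFun := fun s ↦ ⟨⟨s.1, fun {p} hp ↦ s.2.2.1 p hp, s.2.1⟩, ?_, ?_⟩
      left_inv := fun P ↦ rfl
      right_inv := fun s ↦ rfl }
  · have := P.2.1
    rw [zero_add]
    omega
  · intro j hj
    have := P.2.2 j hj
    omega
  · have := s.2.2.2.1
    rw [zero_add] at this
    exact Nat.le_sub_one_of_lt this
  · intro j hj
    exact Nat.le_sub_one_of_lt (s.2.2.2.2 j hj)

/-- Modulo `X ^ m`, the Gordon generating function is the quotient of Andrews' series by the
Euler product. -/
theorem X_pow_dvd_eulerProd_mul_gordonGenFun_sub_gordonSum {k a m : ℕ} (hm : 0 < m) (hk : 0 < k)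
    (hak : a ≤ k) :
    (X : ℤ⟦X⟧) ^ m ∣ eulerProd X m * gordonGenFun k 0 a - gordonSum X m k 0 a := by
  let φ := Ideal.Quotient.mk (Ideal.span {(X : ℤ⟦X⟧) ^ m})
  have hφ : ∀ f g, φ f = φ g ↔ X ^ m ∣ f - g := fun f g ↦ by
    rw [Ideal.Quotient.eq, Ideal.mem_span_singleton]
  have hx : φ X ^ m = 0 := by
    rw [← map_pow, ← map_zero φ, hφ, sub_zero]
  have h := eulerProd_mul_eq_gordonSum hm hx hk (fun N i ↦ φ (gordonGenFun k N i))
    (fun N ↦ by rw [gordonGenFun_zero, map_zero])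
    (fun N i hi ↦ by rw [gordonGenFun_succ hi, map_add, map_mul, map_pow])
    (fun N i hN hi ↦ by
      rw [← map_one φ, hφ]
      exact (pow_dvd_pow _ (by omega)).trans (X_pow_dvd_gordonGenFun_sub_one hk hi N)) 0 a hak
  rw [← hφ, map_mul]
  convert h using 1
  · simp [eulerProd]
  · simp [gordonSum, gordonTerm, shiftedProd]

end Gordon

end RogersRamanujanGordon

open RogersRamanujanGordon PowerSeries in
/-- Rogers–Ramanujan–Gordon theorem: for `1 ≤ a ≤ k`, the number of partitions of `n`
whose parts are not congruent to `0, ±a` modulo `2k+1` equals the number of partitions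
of `n` with `f₁ ≤ a-1` and `fᵢ + f_{i+1} ≤ k-1` for all `i ≥ 1`. -/
theorem rogers_ramanujan_gordon (k a : ℕ) (ha : 1 ≤ a) (hak : a ≤ k) (n : ℕ) :
    Nat.card {P : n.Partition //
        ∀ p ∈ P.parts, p % (2 * k + 1) ≠ 0 ∧ p % (2 * k + 1) ≠ a ∧
          p % (2 * k + 1) ≠ 2 * k + 1 - a} =
    Nat.card {P : n.Partition //
        P.parts.count 1 ≤ a - 1 ∧
        ∀ i : ℕ, 1 ≤ i → P.parts.count i + P.parts.count (i + 1) ≤ k - 1} := by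
  let p : ℕ → Prop := fun p ↦ p % (2 * k + 1) ≠ 0 ∧ p % (2 * k + 1) ≠ a ∧
    p % (2 * k + 1) ≠ 2 * k + 1 - a
  have hA : Nat.card {P : n.Partition // ∀ i ∈ P.parts, p i} =
      #(Nat.Partition.restricted n p) := by
    rw [Nat.card_eq_fintype_card, Fintype.card_subtype]
    rfl
  rw [natCard_partition_eq_ncard_gordonSet ha hak]
  refine hA.trans ?_
  set m := n + 1 with hm
  set A : ℤ⟦X⟧ := PowerSeries.mk fun n ↦ (#(Nat.Partition.restricted n p) : ℤ) with hAdef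
  set L := (2 * k + 1) * m with hL
  have hmL : m ≤ L := Nat.le_mul_of_pos_left _ (by omega)
  have hrestr := (pow_dvd_pow (X : ℤ⟦X⟧) hmL).trans
    (X_pow_dvd_card_restricted_mul_prod_sub_one p L)
  have hsplit : eulerProd (X : ℤ⟦X⟧) L =
      (∏ i ∈ range L, (if p (i + 1) then 1 - X ^ (i + 1) else 1)) *
        ∏ i ∈ range L, (if p (i + 1) then 1 else 1 - X ^ (i + 1)) := by
    rw [← prod_mul_distrib]
    refine prod_congr rfl fun i _ ↦ ?_
    split_ifs <;> simp
  have htriple := X_pow_dvd_tripleProd_sub_gordonSum hak m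
  rw [← prod_residues_eq_tripleProd ha hak p (fun _ ↦ Iff.rfl)] at htriple
  have hgordon := X_pow_dvd_eulerProd_mul_gordonGenFun_sub_gordonSum (a := a)
    (Nat.succ_pos n) (ha.trans hak) hak
  have hEuler : (X : ℤ⟦X⟧) ^ m ∣ eulerProd X L - eulerProd X m := by
    obtain ⟨r, hr⟩ := Nat.exists_eq_add_of_le hmL
    rw [hr]
    exact (pow_dvd_pow _ (Nat.le_succ m)).trans (pow_dvd_eulerProd_sub X m r)
  have hdvd : (X : ℤ⟦X⟧) ^ m ∣ eulerProd X m * (A - gordonGenFun k 0 a) := by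
    have h1 := hrestr.mul_right (∏ i ∈ range L, (if p (i + 1) then 1 else 1 - X ^ (i + 1)))
    have h2 := hEuler.mul_right A
    have := dvd_sub (dvd_sub (dvd_add h1 htriple) h2) hgordon
    convert this using 1
    rw [hsplit]
    ring
  have hcong := (isCoprime_eulerProd_right (X : ℤ⟦X⟧) m m).dvd_of_dvd_mul_left hdvd
  have hcoeff := X_pow_dvd_iff.mp hcong n (Nat.lt_succ_self n)
  rw [map_sub, sub_eq_zero, hAdef, gordonGenFun, coeff_mk, coeff_mk] at hcoeff
  exact_mod_cast hcoeff
end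

section
/- Let k and a be integers with 2 ≤ k and 1 ≤ a ≤ k, and let q be a complex number with |q| < 1. Then ∑_{n_1,…,n_{k−1} ≥ 0} q^{N_1² + N_2² + ⋯ + N_{k−1}² + N_a + N_{a+1} + ⋯ + N_{k−1}} / ((q;q)_{n_1} (q;q)_{n_2} ⋯ (q;q)_{n_{k−1}}) = (q^a, q^{2k+1−a}, q^{2k+1}; q^{2k+1})_∞ / (q;q)_∞, where the sum on the left converges absolutely. -/
open Finset

/-- Finite q-Pochhammer symbol `(x;q)_n`. -/
noncomputable def qPoch (q x : ℂ) (n : ℕ) : ℂ :=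
  ∏ j ∈ Finset.range n, (1 - x * q ^ j)

/-- Infinite q-Pochhammer symbol `(x;q)_∞`. -/
noncomputable def qPochInf (q x : ℂ) : ℂ :=
  ∏' j : ℕ, (1 - x * q ^ j)

/-- `Nsum m n i = n_i + n_{i+1} + ⋯ + n_m` (1-based), where `n : Fin m → ℕ` lists
`n_1, …, n_m`; in particular `Nsum m n i = 0` for `i > m`. -/
def Nsum (m : ℕ) (n : Fin m → ℕ) (i : ℕ) : ℕ :=
  ∑ j : Fin m, if i ≤ (j : ℕ) + 1 then n j else 0

/-- Summand of the Andrews–Gordon identity. -/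
noncomputable def agTerm (k a : ℕ) (q : ℂ) (n : Fin (k - 1) → ℕ) : ℂ :=
  q ^ ((∑ i ∈ Finset.Icc 1 (k - 1), (Nsum (k - 1) n i) ^ 2) +
        ∑ i ∈ Finset.Icc a (k - 1), Nsum (k - 1) n i) /
    ∏ j : Fin (k - 1), qPoch q q (n j)

open Filter Topology

/-- The reciprocal `1 / (q;q)_m`, extended by zero to negative `m`. -/
noncomputable def invQPoch (q : ℂ) (m : ℤ) : ℂ :=
  if 0 ≤ m then (qPoch q q m.toNat)⁻¹ else 0

lemma invQPoch_natCast (q : ℂ) (n : ℕ) : invQPoch q n = (qPoch q q n)⁻¹ := by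
  simp [invQPoch]

lemma invQPoch_of_neg (q : ℂ) {m : ℤ} (hm : m < 0) : invQPoch q m = 0 := by
  simp [invQPoch, hm]

lemma invQPoch_zero (q : ℂ) : invQPoch q 0 = 1 := by
  simp [invQPoch, qPoch]

lemma one_sub_pow_succ_ne_zero {q : ℂ} (hq : ‖q‖ < 1) (n : ℕ) : 1 - q ^ (n + 1) ≠ 0 := by
  intro h
  have h1 : ‖q ^ (n + 1)‖ = 1 := by rw [← sub_eq_zero.mp h]; simp
  rw [norm_pow] at h1
  exact (pow_lt_one₀ (norm_nonneg q) hq n.succ_ne_zero).ne h1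

lemma qPoch_self_succ (q : ℂ) (n : ℕ) : qPoch q q (n + 1) = qPoch q q n * (1 - q ^ (n + 1)) := by
  rw [qPoch, prod_range_succ, ← qPoch, pow_succ']

lemma one_sub_zpow_mul_invQPoch {q : ℂ} (hq : ‖q‖ < 1) (m : ℤ) :
    (1 - q ^ m) * invQPoch q m = invQPoch q (m - 1) := by
  rcases lt_or_ge m 0 with hm | hm
  · rw [invQPoch_of_neg q hm, invQPoch_of_neg q (by lia), mul_zero]
  · obtain ⟨n, rfl⟩ := Int.eq_ofNat_of_zero_le hm
    cases n with
    | zero => simp [invQPoch_of_neg]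
    | succ n =>
      have h := one_sub_pow_succ_ne_zero hq n
      rw [show ((n + 1 : ℕ) : ℤ) - 1 = (n : ℕ) by push_cast; ring, invQPoch_natCast,
        invQPoch_natCast, qPoch_self_succ, zpow_natCast, mul_inv]
      field_simp

lemma summable_norm_mul_pow {q : ℂ} (hq : ‖q‖ < 1) (x : ℂ) :
    Summable fun j : ℕ => ‖-(x * q ^ j)‖ := by
  simpa using (summable_geometric_of_lt_one (norm_nonneg q) hq).mul_left ‖x‖

lemma tendsto_qPoch {q : ℂ} (hq : ‖q‖ < 1) (x : ℂ) :
    Tendsto (qPoch q x) atTop (𝓝 (qPochInf q x)) := by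
  have h := (multipliable_one_add_of_summable (summable_norm_mul_pow hq x)).hasProd.tendsto_prod_nat
  simp only [← sub_eq_add_neg] at h
  exact h

lemma qPochInf_self_ne_zero {q : ℂ} (hq : ‖q‖ < 1) : qPochInf q q ≠ 0 := by
  have h := tprod_one_add_ne_zero_of_summable (f := fun j : ℕ => -(q * q ^ j))
    (fun j => by
      rw [← sub_eq_add_neg, ← pow_succ']
      exact one_sub_pow_succ_ne_zero hq j) (summable_norm_mul_pow hq q)
  simp only [← sub_eq_add_neg] at h
  exact h

lemma tendsto_invQPoch {q : ℂ} (hq : ‖q‖ < 1) :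
    Tendsto (invQPoch q) atTop (𝓝 (qPochInf q q)⁻¹) := by
  have htoNat : Tendsto Int.toNat atTop atTop :=
    tendsto_atTop_mono (fun m => by lia : ∀ m : ℤ, m ≤ (m.toNat : ℤ)) tendsto_id
      |> tendsto_natCast_atTop_iff.mp
  have h := ((tendsto_qPoch hq q).inv₀ (qPochInf_self_ne_zero hq)).comp htoNat
  refine h.congr' ?_
  filter_upwards [eventually_ge_atTop 0] with m hm
  simp [invQPoch, hm]

lemma exists_norm_invQPoch_le {q : ℂ} (hq : ‖q‖ < 1) :
    ∃ C : ℝ, 0 ≤ C ∧ ∀ m, ‖invQPoch q m‖ ≤ C := by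
  have h := (tendsto_invQPoch hq).comp tendsto_natCast_atTop_atTop
  obtain ⟨C, hC⟩ := (Metric.isBounded_range_of_tendsto _ h).exists_norm_le
  have hC' : ∀ n : ℕ, ‖invQPoch q n‖ ≤ C := fun n => hC _ ⟨n, rfl⟩
  have hC0 := (norm_nonneg _).trans (hC' 0)
  refine ⟨C, hC0, fun m => ?_⟩
  rcases lt_or_ge m 0 with hm | hm
  · simpa [invQPoch_of_neg q hm] using hC0
  · obtain ⟨n, rfl⟩ := Int.eq_ofNat_of_zero_le hm
    exact hC' n

/-- The limiting case of the `q`-Chu–Vandermonde sum. -/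
lemma sum_zpow_mul_invQPoch {q : ℂ} (hq0 : q ≠ 0) (hq : ‖q‖ < 1) (M d : ℕ) :
    ∑ t ∈ range (M + 1), q ^ ((t : ℤ) * (t + d)) * invQPoch q (M - t) * invQPoch q t *
      invQPoch q (t + d) = invQPoch q M * invQPoch q (M + d) := by
  induction M generalizing d with
  | zero => simp [invQPoch_zero]
  | succ M ih =>
    have hne : (1 - q ^ ((M : ℤ) + 1)) ≠ 0 := by
      exact_mod_cast one_sub_pow_succ_ne_zero hq M
    apply mul_left_cancel₀ hne
    have hsplit : ∀ t : ℕ, (1 - q ^ ((M : ℤ) + 1)) * (q ^ ((t : ℤ) * (t + d)) *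
        invQPoch q (((M + 1 : ℕ) : ℤ) - t) * invQPoch q t * invQPoch q (t + d)) =
        q ^ ((t : ℤ) * (t + d) + t) * invQPoch q (M - t) * invQPoch q t * invQPoch q (t + d) +
        q ^ ((t : ℤ) * (t + d)) * invQPoch q (M + 1 - t) * invQPoch q (t - 1) *
          invQPoch q (t + d) := by
      intro t
      have h1 := one_sub_zpow_mul_invQPoch hq ((M : ℤ) + 1 - t)
      have h2 := one_sub_zpow_mul_invQPoch hq (t : ℤ)
      rw [show (M : ℤ) + 1 - t - 1 = M - t by ring] at h1
      rw [← h1, ← h2, zpow_add₀ hq0 _ (t : ℤ), Nat.cast_succ,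
        show (M : ℤ) + 1 = (M + 1 - t) + t by ring, zpow_add₀ hq0 _ (t : ℤ)]
      simp only [add_sub_cancel_right]
      ring
    rw [mul_sum, sum_congr rfl fun t _ => hsplit t, sum_add_distrib, sum_range_succ,
      sum_range_succ' (n := M + 1)]
    have hlast : invQPoch q ((M : ℤ) - ((M + 1 : ℕ) : ℤ)) = 0 := invQPoch_of_neg q (by lia)
    have hfirst : invQPoch q (((0 : ℕ) : ℤ) - 1) = 0 := invQPoch_of_neg q (by lia)
    rw [hlast, hfirst]
    simp only [mul_zero, zero_mul, add_zero]
    rw [← sum_add_distrib]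
    have ih' := ih (d + 1)
    have hM := one_sub_zpow_mul_invQPoch hq ((M : ℤ) + 1)
    rw [add_sub_cancel_right] at hM
    rw [← mul_assoc, Nat.cast_succ, hM, show (M : ℤ) + 1 + d = M + ((d + 1 : ℕ) : ℤ) by
      push_cast; ring, ← ih']
    refine sum_congr rfl fun t _ => ?_
    have h3 := one_sub_zpow_mul_invQPoch hq ((t : ℤ) + d + 1)
    rw [add_sub_cancel_right] at h3
    rw [← h3]
    push_cast
    rw [show (M : ℤ) + 1 - (t + 1) = M - t by ring, show (t : ℤ) + 1 - 1 = t by ring,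
      show (t : ℤ) + 1 + d = t + d + 1 by ring, show (t : ℤ) + (d + 1) = t + d + 1 by ring,
      show ((t : ℤ) + 1) * (t + d + 1) = t * (t + d) + t + (t + d + 1) by ring,
      show (t : ℤ) * (t + d + 1) = t * (t + d) + t by ring, zpow_add₀ hq0 _ ((t : ℤ) + d + 1)]
    ring

/-- The kernel `1 / ((q;q)_{n-j} (q;q)_{n+j+d})` of a bilateral Bailey pair. -/
noncomputable def baileyKernel (q : ℂ) (d : ℕ) (n j : ℤ) : ℂ :=
  invQPoch q (n - j) * invQPoch q (n + j + d)

lemma baileyKernel_reflect (q : ℂ) (d : ℕ) (n j : ℤ) :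
    baileyKernel q d n (-d - j) = baileyKernel q d n j := by
  rw [baileyKernel, baileyKernel, mul_comm]
  ring_nf

lemma sum_mul_baileyKernel {q : ℂ} (hq0 : q ≠ 0) (hq : ‖q‖ < 1) {d : ℕ} (hd : d ≤ 1) (L : ℕ)
    (j : ℤ) :
    ∑ s ∈ range (L + 1), q ^ ((s : ℤ) ^ 2 + d * s) * baileyKernel q d s j * invQPoch q (L - s) =
      q ^ (j ^ 2 + d * j) * baileyKernel q d L j := by
  wlog hj : 0 ≤ j generalizing j
  · have h := this (-d - j) (by lia)
    simp only [baileyKernel_reflect] at h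
    rw [h]
    congr 2
    ring
  obtain ⟨i, rfl⟩ := Int.eq_ofNat_of_zero_le hj
  rcases lt_or_ge L i with hL | hL
  · rw [baileyKernel, invQPoch_of_neg q (m := (L : ℤ) - i) (by lia), zero_mul, mul_zero]
    refine sum_eq_zero fun s hs => ?_
    have hs' := mem_range.mp hs
    rw [baileyKernel, invQPoch_of_neg q (m := (s : ℤ) - i) (by lia)]
    ring
  · obtain ⟨M, rfl⟩ := Nat.exists_eq_add_of_le hL
    rw [add_assoc, sum_range_add, sum_eq_zero, zero_add]
    · have h := sum_zpow_mul_invQPoch hq0 hq M (2 * i + d)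
      rw [baileyKernel]
      push_cast at h ⊢
      rw [show (i : ℤ) + M - i = M by ring, show (i : ℤ) + M + i + d = M + (2 * i + d) by ring, ← h,
        mul_sum]
      refine sum_congr rfl fun t _ => ?_
      rw [baileyKernel, show (i : ℤ) + t - i = t by ring,
        show (i : ℤ) + t + i + d = t + (2 * i + d) by ring,
        show (i : ℤ) + M - (i + t) = M - t by ring,
        show ((i : ℤ) + t) ^ 2 + d * (i + t) = (i ^ 2 + d * i) + t * (t + (2 * i + d)) by ring,
        zpow_add₀ hq0]
      ring
    · intro s hs
      have hs' := mem_range.mp hs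
      rw [baileyKernel, invQPoch_of_neg q (m := (s : ℤ) - i) (by lia)]
      ring

/-- The range `-B-1, …, B` is symmetric under `j ↦ -1 - j`. -/
lemma sum_Icc_reflect (B : ℕ) (f : ℤ → ℂ) :
    ∑ j ∈ Icc (-(B : ℤ) - 1) B, f (-1 - j) = ∑ j ∈ Icc (-(B : ℤ) - 1) B, f j := by
  refine sum_nbij' (fun j => -1 - j) (fun j => -1 - j) ?_ ?_ ?_ ?_ ?_ <;> intro j hj <;>
    simp only [mem_Icc] at * <;> lia

lemma sum_Icc_shift (B : ℕ) (f : ℤ → ℂ) (hl : f (-(B : ℤ) - 1) = 0) (hr : f (B + 1) = 0) :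
    ∑ j ∈ Icc (-(B : ℤ) - 1) B, f (j + 1) = ∑ j ∈ Icc (-(B : ℤ) - 1) B, f j := by
  trans ∑ j ∈ Icc (-(B : ℤ) - 1) (B + 1), f j
  · trans ∑ j ∈ Icc (-(B : ℤ)) (B + 1), f j
    · refine sum_nbij' (fun j => j + 1) (fun j => j - 1) ?_ ?_ ?_ ?_ ?_ <;> intro j hj <;>
        simp only [mem_Icc] at * <;> lia
    · refine sum_subset (Icc_subset_Icc_left (by lia)) fun j hj hj' => ?_
      simp only [mem_Icc] at hj hj'
      rwa [show j = -(B : ℤ) - 1 by lia]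
  · refine (sum_subset (Icc_subset_Icc_right (by lia)) fun j hj hj' => ?_).symm
    simp only [mem_Icc] at hj hj'
    rwa [show j = (B : ℤ) + 1 by lia]

/-- One step along the Bailey chain. -/
lemma bailey_step {q : ℂ} (hq0 : q ≠ 0) (hq : ‖q‖ < 1) {d : ℕ} (hd : d ≤ 1) (S : Finset ℤ)
    (γ : ℤ → ℂ) (β : ℕ → ℂ) (L : ℕ)
    (h : ∀ s ≤ L, β s = ∑ j ∈ S, γ j * baileyKernel q d s j) :
    ∑ s ∈ range (L + 1), q ^ ((s : ℤ) ^ 2 + d * s) * β s * invQPoch q (L - s) =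
      ∑ j ∈ S, γ j * q ^ (j ^ 2 + d * j) * baileyKernel q d L j := by
  simp_rw [mul_assoc (γ _), ← sum_mul_baileyKernel hq0 hq hd, mul_sum]
  rw [sum_comm]
  refine sum_congr rfl fun s hs => ?_
  rw [h s (by simpa [Nat.lt_succ_iff] using hs), mul_sum, sum_mul]
  refine sum_congr rfl fun j _ => ?_
  ring

lemma sum_baileyKernel_one_eq_sum_baileyKernel_zero {q : ℂ} (hq0 : q ≠ 0)
    (hq : ‖q‖ < 1) (B : ℕ) (n : ℤ)
    (γ : ℤ → ℂ) (hγ : ∀ j, γ (-1 - j) = -(q ^ (2 * j + 1) * γ j)) :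
    ∑ j ∈ Icc (-(B : ℤ) - 1) B, γ j * baileyKernel q 1 n j =
      ∑ j ∈ Icc (-(B : ℤ) - 1) B, γ j * baileyKernel q 0 n j := by
  have hK : ∀ j, γ j * baileyKernel q 0 n j = γ j * baileyKernel q 1 n j -
      γ j * q ^ (n + j + 1) * baileyKernel q 1 n j := by
    intro j
    have h := one_sub_zpow_mul_invQPoch hq (n + j + 1)
    rw [add_sub_cancel_right] at h
    simp only [baileyKernel, Nat.cast_zero, Nat.cast_one, add_zero, ← h]
    ring
  have hodd : ∑ j ∈ Icc (-(B : ℤ) - 1) B, γ j * q ^ (n + j + 1) * baileyKernel q 1 n j = 0 := by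
    rw [← self_eq_neg]
    conv_lhs => rw [← sum_Icc_reflect]
    rw [← sum_neg_distrib]
    refine sum_congr rfl fun j _ => ?_
    have h := baileyKernel_reflect q 1 n j
    rw [Nat.cast_one] at h
    have hpow : q ^ (n + j + 1) = q ^ (2 * j + 1) * q ^ (n + (-1 - j) + 1) := by
      rw [← zpow_add₀ hq0]
      congr 1
      ring
    rw [h, hγ, hpow]
    ring
  rw [sum_congr rfl fun j _ => hK j, sum_sub_distrib, hodd, sub_zero]

/-- The coefficients `(-1)^j q^{j(j-1)/2}`. -/
noncomputable def signedTri (q : ℂ) (j : ℤ) : ℂ :=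
  (-1) ^ j * q ^ (j * (j - 1) / 2)

lemma signedTri_succ {q : ℂ} (hq0 : q ≠ 0) (j : ℤ) :
    signedTri q (j + 1) = -(q ^ j * signedTri q j) := by
  have h : (j + 1) * (j + 1 - 1) / 2 = j * (j - 1) / 2 + j := by
    rw [show (j + 1) * (j + 1 - 1) = j * (j - 1) + j * 2 by ring,
      Int.add_mul_ediv_right _ _ two_ne_zero]
  rw [signedTri, signedTri, h, zpow_add₀ hq0, zpow_add₀ (by norm_num : (-1 : ℂ) ≠ 0), zpow_one]
  ring

lemma signedTri_one_sub {q : ℂ} (j : ℤ) : signedTri q (1 - j) = -signedTri q j := by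
  rw [signedTri, signedTri, show (1 - j) * (1 - j - 1) = j * (j - 1) by ring,
    zpow_sub₀ (by norm_num : (-1 : ℂ) ≠ 0), zpow_one, div_eq_mul_inv, ← inv_zpow, inv_neg_one]
  ring

lemma signedTri_reflect {q : ℂ} (hq0 : q ≠ 0) (j : ℤ) :
    signedTri q (-1 - j) = -(q ^ (2 * j + 1) * signedTri q j) := by
  have hpow : q ^ (2 * j + 1) = q ^ (j + 1) * q ^ j := by
    rw [← zpow_add₀ hq0]
    congr 1
    ring
  rw [show -1 - j = 1 - (j + 1 + 1) by ring, signedTri_one_sub, signedTri_succ hq0,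
    signedTri_succ hq0, hpow]
  ring

/-- The unit Bailey pair. -/
lemma sum_signedTri_mul_baileyKernel {q : ℂ} (hq0 : q ≠ 0) (hq : ‖q‖ < 1) {B n : ℕ} (hn : n ≤ B) :
    ∑ j ∈ Icc (-(B : ℤ) - 1) B, signedTri q j * baileyKernel q 0 n j = if n = 0 then 1 else 0 := by
  rcases Nat.eq_zero_or_pos n with rfl | hpos
  · rw [sum_eq_single 0]
    · simp [signedTri, baileyKernel, invQPoch_zero]
    · intro j _ hj
      rcases lt_or_gt_of_ne hj with h | h
      · rw [baileyKernel, invQPoch_of_neg q (m := _ + j + _) (by simpa using h)]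
        simp
      · rw [baileyKernel, invQPoch_of_neg q (m := _ - j) (by simpa using h)]
        simp
    · intro h
      simp only [mem_Icc, not_and_or] at h
      lia
  · rw [if_neg hpos.ne']
    have hne : (1 - q ^ (2 * (n : ℤ))) ≠ 0 := by
      obtain ⟨p, hp⟩ : ∃ p, 2 * n = p + 1 := ⟨2 * n - 1, by lia⟩
      have h := one_sub_pow_succ_ne_zero hq p
      rw [← hp] at h
      exact_mod_cast h
    -- `g j` and `g (1 - j)` cancel
    set g : ℤ → ℂ := fun j => signedTri q j * (invQPoch q (n - j) * invQPoch q (n + j - 1)) with hg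
    have hterm : ∀ j, (1 - q ^ (2 * (n : ℤ))) * (signedTri q j * baileyKernel q 0 n j) =
        g j - q ^ (n : ℤ) * g (j + 1) := by
      intro j
      have h1 := one_sub_zpow_mul_invQPoch hq ((n : ℤ) - j)
      have h2 := one_sub_zpow_mul_invQPoch hq ((n : ℤ) + j)
      have hp1 : q ^ (2 * (n : ℤ)) = q ^ ((n : ℤ) + j) * q ^ ((n : ℤ) - j) := by
        rw [← zpow_add₀ hq0]
        congr 1
        ring
      have hp2 : q ^ ((n : ℤ) + j) = q ^ (n : ℤ) * q ^ j := zpow_add₀ hq0 _ _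
      simp only [hg, baileyKernel, signedTri_succ hq0, Nat.cast_zero, add_zero]
      rw [show (n : ℤ) - (j + 1) = n - j - 1 by ring, show (n : ℤ) + (j + 1) - 1 = n + j by ring,
        ← h1, ← h2, hp1, hp2]
      ring
    have hzero : ∑ j ∈ Icc (-(B : ℤ) - 1) B, g (j + 1) = 0 := by
      rw [← self_eq_neg]
      conv_lhs => rw [← sum_Icc_reflect]
      rw [← sum_neg_distrib]
      refine sum_congr rfl fun j _ => ?_
      simp only [hg]
      rw [show -1 - j + 1 = 1 - (j + 1) by ring, signedTri_one_sub,
        show (n : ℤ) - (1 - (j + 1)) = n + (j + 1) - 1 by ring,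
        show (n : ℤ) + (1 - (j + 1)) - 1 = n - (j + 1) by ring]
      ring
    have hshift : ∑ j ∈ Icc (-(B : ℤ) - 1) B, g j = ∑ j ∈ Icc (-(B : ℤ) - 1) B, g (j + 1) := by
      refine (sum_Icc_shift B g ?_ ?_).symm
      · simp [hg, invQPoch_of_neg q (m := (n : ℤ) + (-B - 1) - 1) (by lia)]
      · simp [hg, invQPoch_of_neg q (m := (n : ℤ) - (B + 1)) (by lia)]
    apply mul_left_cancel₀ hne
    rw [mul_sum, sum_congr rfl fun j _ => hterm j, sum_sub_distrib, ← mul_sum, hshift, hzero]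
    ring

lemma signedTri_pred {q : ℂ} (hq0 : q ≠ 0) (j : ℤ) :
    signedTri q j = -(q ^ (j - 1) * signedTri q (j - 1)) := by
  rw [← signedTri_succ hq0, sub_add_cancel]

/-- The finite Jacobi triple product. -/
lemma sum_signedTri_mul_zpow {q z : ℂ} (hq0 : q ≠ 0) (hq : ‖q‖ < 1) (hz : z ≠ 0) {B n : ℕ}
    (hn : n ≤ B) :
    ∑ j ∈ Icc (-(B : ℤ) - 1) B, signedTri q j * z ^ j * baileyKernel q 0 n j =
      qPoch q z n * qPoch q (q / z) n * invQPoch q (2 * n) := by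
  induction n with
  | zero =>
    rw [sum_eq_single 0]
    · simp [signedTri, baileyKernel, invQPoch_zero, qPoch]
    · intro j _ hj
      rcases lt_or_gt_of_ne hj with h | h
      · rw [baileyKernel, invQPoch_of_neg q (m := _ + j + _) (by simpa using h)]
        simp
      · rw [baileyKernel, invQPoch_of_neg q (m := _ - j) (by simpa using h)]
        simp
    · intro h
      simp only [mem_Icc, not_and_or] at h
      lia
  | succ n ih =>
    specialize ih (by lia)
    have hne1 : (1 - q ^ (2 * (n : ℤ) + 1)) ≠ 0 := by
      exact_mod_cast one_sub_pow_succ_ne_zero hq (2 * n)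
    have hne2 : (1 - q ^ (2 * (n : ℤ) + 2)) ≠ 0 := by
      exact_mod_cast one_sub_pow_succ_ne_zero hq (2 * n + 1)
    set c : ℤ → ℂ := fun j => signedTri q j * z ^ j * baileyKernel q 0 n j with hc
    have hc0 : ∀ j : ℤ, (n : ℤ) < j ∨ j < -n → c j = 0 := by
      rintro j (h | h)
      · simp [hc, baileyKernel, invQPoch_of_neg q (m := (n : ℤ) - j) (by lia)]
      · simp [hc, baileyKernel, invQPoch_of_neg q (m := (n : ℤ) + j) (by lia)]
    have hterm : ∀ j, (1 - q ^ (2 * (n : ℤ) + 1)) * (1 - q ^ (2 * (n : ℤ) + 2)) *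
        (signedTri q j * z ^ j * baileyKernel q 0 (n + 1 : ℕ) j) =
        (1 + q ^ (2 * (n : ℤ) + 1)) * c j - z * q ^ (n : ℤ) * c (j - 1) -
          q / z * q ^ (n : ℤ) * c (j + 1) := by
      intro j
      have h1 := one_sub_zpow_mul_invQPoch hq ((n : ℤ) + 1 - j)
      have h2 := one_sub_zpow_mul_invQPoch hq ((n : ℤ) + 1 + j)
      have h3 := one_sub_zpow_mul_invQPoch hq ((n : ℤ) - j)
      have h4 := one_sub_zpow_mul_invQPoch hq ((n : ℤ) + j)
      rw [show (n : ℤ) + 1 - j - 1 = n - j by ring] at h1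
      rw [show (n : ℤ) + 1 + j - 1 = n + j by ring] at h2
      simp only [hc, baileyKernel, signedTri_succ hq0, Nat.cast_zero, add_zero]
      have hpred : signedTri q (j - 1) = - (q ^ (1 - j) * signedTri q j) := by
        rw [signedTri_pred hq0 j, mul_neg, neg_neg, ← mul_assoc, ← zpow_add₀ hq0]
        simp
      push_cast
      rw [hpred, zpow_add₀ hz, zpow_sub₀ hz, zpow_one,
        show (n : ℤ) - (j + 1) = n - j - 1 by ring, show (n : ℤ) + (j - 1) = n + j - 1 by ring,
        show (n : ℤ) - (j - 1) = n + 1 - j by ring, show (n : ℤ) + (j + 1) = n + 1 + j by ring,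
        ← h3, ← h4, ← h1, ← h2]
      simp only [zpow_add₀ hq0, zpow_sub₀ hq0, zpow_one, zpow_two, two_mul]
      have hqj : q ^ j ≠ 0 := zpow_ne_zero _ hq0
      generalize invQPoch q _ = R1
      generalize invQPoch q _ = R2
      generalize q ^ j = x at *
      generalize q ^ (n : ℤ) = y
      field_simp
      ring
    have hshift1 : ∑ j ∈ Icc (-(B : ℤ) - 1) B, c (j + 1) = ∑ j ∈ Icc (-(B : ℤ) - 1) B, c j :=
      sum_Icc_shift B c (hc0 _ (by lia)) (hc0 _ (by lia))
    have hshift2 : ∑ j ∈ Icc (-(B : ℤ) - 1) B, c j = ∑ j ∈ Icc (-(B : ℤ) - 1) B, c (j - 1) := by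
      have h := sum_Icc_shift B (fun j => c (j - 1)) (hc0 _ (by lia)) (hc0 _ (by lia))
      simpa using h
    apply mul_left_cancel₀ (mul_ne_zero hne1 hne2)
    rw [mul_sum, sum_congr rfl fun j _ => hterm j, sum_sub_distrib, sum_sub_distrib, ← mul_sum,
      ← mul_sum, ← mul_sum, hshift1, ← hshift2, ih]
    have h1 := one_sub_zpow_mul_invQPoch hq (2 * (n : ℤ) + 1)
    have h2 := one_sub_zpow_mul_invQPoch hq (2 * (n : ℤ) + 2)
    rw [add_sub_cancel_right] at h1
    rw [show 2 * (n : ℤ) + 2 - 1 = 2 * n + 1 by ring] at h2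
    rw [← h1, ← h2, qPoch, qPoch, qPoch, qPoch, prod_range_succ, prod_range_succ, Nat.cast_succ,
      show 2 * ((n : ℤ) + 1) = 2 * n + 2 by ring]
    simp only [zpow_add₀ hq0, zpow_one, zpow_two, two_mul, zpow_natCast]
    field_simp
    ring

lemma sum_Icc_eq_tsum (q : ℂ) (γ : ℤ → ℂ) {B n : ℕ} (hn : n ≤ B) :
    ∑ j ∈ Icc (-(B : ℤ) - 1) B, γ j * baileyKernel q 0 n j =
      ∑' j : ℤ, γ j * baileyKernel q 0 n j := by
  refine (tsum_eq_sum fun j hj => ?_).symm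
  simp only [mem_Icc, not_and_or, not_le] at hj
  rcases hj with h | h
  · simp [baileyKernel, invQPoch_of_neg q (m := (n : ℤ) + j) (by lia)]
  · simp [baileyKernel, invQPoch_of_neg q (m := (n : ℤ) - j) (by lia)]

lemma tendsto_tsum_baileyKernel {q : ℂ} (hq : ‖q‖ < 1) (γ : ℤ → ℂ) (hγ : Summable fun j => ‖γ j‖) :
    Tendsto (fun n : ℕ => ∑' j : ℤ, γ j * baileyKernel q 0 n j) atTop
      (𝓝 ((∑' j, γ j) * ((qPochInf q q)⁻¹ * (qPochInf q q)⁻¹))) := by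
  obtain ⟨C, hC0, hC⟩ := exists_norm_invQPoch_le hq
  rw [← tsum_mul_right]
  refine tendsto_tsum_of_dominated_convergence (bound := fun j => ‖γ j‖ * (C * C))
    (hγ.mul_right _) (fun j => ?_) (Eventually.of_forall fun n j => ?_)
  · have hcast : Tendsto (fun n : ℕ => (n : ℤ)) atTop atTop := tendsto_natCast_atTop_atTop
    refine Tendsto.const_mul _ (Tendsto.mul ?_ ?_)
    · exact (tendsto_invQPoch hq).comp (tendsto_atTop_add_const_right _ (-j) hcast)
    · simp only [Nat.cast_zero, add_zero]
      exact (tendsto_invQPoch hq).comp (tendsto_atTop_add_const_right _ j hcast)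
  · rw [norm_mul, baileyKernel, norm_mul]
    gcongr
    · exact hC _
    · exact hC _

/-- The Jacobi triple product. -/
lemma tsum_signedTri_mul_zpow {q z : ℂ} (hq0 : q ≠ 0) (hq : ‖q‖ < 1) (hz : z ≠ 0)
    (hsum : Summable fun j : ℤ => ‖signedTri q j * z ^ j‖) :
    ∑' j : ℤ, signedTri q j * z ^ j = qPochInf q z * qPochInf q (q / z) * qPochInf q q := by
  have h1 := tendsto_tsum_baileyKernel hq _ hsum
  have h2 : Tendsto (fun n : ℕ => qPoch q z n * qPoch q (q / z) n * invQPoch q (2 * n)) atTop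
      (𝓝 (qPochInf q z * qPochInf q (q / z) * (qPochInf q q)⁻¹)) := by
    refine ((tendsto_qPoch hq z).mul (tendsto_qPoch hq (q / z))).mul ?_
    refine (tendsto_invQPoch hq).comp ?_
    exact (tendsto_natCast_atTop_atTop (R := ℤ)).const_mul_atTop' two_pos
  have h := tendsto_nhds_unique h1 (h2.congr fun n => by
    rw [← sum_signedTri_mul_zpow hq0 hq hz le_rfl, sum_Icc_eq_tsum q _ le_rfl])
  have hne := qPochInf_self_ne_zero hq
  field_simp at h
  rw [h]
  ring

/-- The Andrews–Gordon summand in `m` variables, with the linear term present for the last `r`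
partial sums. -/
noncomputable def agSummand (q : ℂ) (m r : ℕ) (n : Fin m → ℕ) : ℂ :=
  q ^ (∑ i ∈ range m, (Nsum m n (i + 1) ^ 2 + if m ≤ i + r then Nsum m n (i + 1) else 0)) *
    ∏ j, invQPoch q (n j)

lemma Nsum_one (m : ℕ) (n : Fin m → ℕ) : Nsum m n 1 = ∑ j, n j := by
  simp [Nsum]

lemma Nsum_cons_succ (m x : ℕ) (n : Fin m → ℕ) (i : ℕ) :
    Nsum (m + 1) (Fin.cons x n) (i + 1 + 1) = Nsum m n (i + 1) := by
  simp [Nsum, Fin.sum_univ_succ]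

lemma agSummand_cons (q : ℂ) (m r x : ℕ) (n : Fin m → ℕ) :
    agSummand q (m + 1) r (Fin.cons x n) =
      q ^ ((x + ∑ j, n j) ^ 2 + if m + 1 ≤ r then x + ∑ j, n j else 0) *
        (invQPoch q x * agSummand q m r n) := by
  have hcond : ∀ i, m + 1 ≤ i + 1 + r ↔ m ≤ i + r := fun i => by lia
  simp only [agSummand, sum_range_succ', Nsum_cons_succ, zero_add, Nsum_one, Fin.sum_cons, hcond,
    Fin.prod_univ_succ, Fin.cons_zero, Fin.cons_succ, pow_add]
  ring

/-- The part of the Andrews–Gordon sum with `N_1 = s`. -/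
noncomputable def agFiber (q : ℂ) (m r s : ℕ) : ℂ :=
  ∑ n ∈ Finset.Nat.antidiagonalTuple m s, agSummand q m r n

/-- The finite analogue of the Andrews–Gordon sum. -/
noncomputable def agFinite (q : ℂ) (m r L : ℕ) : ℂ :=
  ∑ s ∈ range (L + 1), agFiber q m r s * invQPoch q (L - s)

lemma sum_antidiagonalTuple_succ (m s : ℕ) (f : (Fin (m + 1) → ℕ) → ℂ) :
    ∑ n ∈ Finset.Nat.antidiagonalTuple (m + 1) s, f n =
      ∑ t ∈ range (s + 1), ∑ n ∈ Finset.Nat.antidiagonalTuple m t, f (Fin.cons (s - t) n) := by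
  rw [sum_sigma']
  refine sum_nbij' (fun n => ⟨∑ j, Fin.tail n j, Fin.tail n⟩) (fun p => Fin.cons (s - p.1) p.2)
    ?_ ?_ ?_ ?_ ?_
  · intro n hn
    simp only [Finset.Nat.mem_antidiagonalTuple, Fin.sum_univ_succ] at hn
    simp only [mem_sigma, mem_range, Finset.Nat.mem_antidiagonalTuple, Fin.tail, and_true]
    lia
  · rintro ⟨t, n⟩ hp
    simp only [mem_sigma, mem_range, Finset.Nat.mem_antidiagonalTuple] at hp
    simp only [Finset.Nat.mem_antidiagonalTuple, Fin.sum_cons]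
    lia
  · intro n hn
    simp only [Finset.Nat.mem_antidiagonalTuple, Fin.sum_univ_succ] at hn
    rw [show s - ∑ j, Fin.tail n j = n 0 by simp only [Fin.tail]; lia, Fin.cons_self_tail]
  · rintro ⟨t, n⟩ hp
    simp only [mem_sigma, mem_range, Finset.Nat.mem_antidiagonalTuple] at hp
    obtain ⟨_, rfl⟩ := hp
    simp
  · intro n hn
    simp only [Finset.Nat.mem_antidiagonalTuple, Fin.sum_univ_succ] at hn
    rw [show s - ∑ j, Fin.tail n j = n 0 by simp only [Fin.tail]; lia, Fin.cons_self_tail]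

lemma agFiber_succ (q : ℂ) (m r s : ℕ) :
    agFiber q (m + 1) r s = q ^ (s ^ 2 + if m + 1 ≤ r then s else 0) * agFinite q m r s := by
  rw [agFiber, sum_antidiagonalTuple_succ, agFinite, mul_sum]
  refine sum_congr rfl fun t ht => ?_
  have hts : t ≤ s := by simpa [Nat.lt_succ_iff] using ht
  rw [agFiber, sum_mul, mul_sum]
  refine sum_congr rfl fun n hn => ?_
  rw [agSummand_cons, (Finset.Nat.mem_antidiagonalTuple).mp hn, Nat.sub_add_cancel hts,
    Nat.cast_sub hts]
  ring

lemma agFinite_zero (q : ℂ) (r L : ℕ) : agFinite q 0 r L = invQPoch q L := by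
  rw [agFinite, sum_range_succ']
  simp [agFiber, agSummand]

/-- The inner part of the Bailey chain, relative to `q`. -/
lemma agFinite_of_le {q : ℂ} (hq0 : q ≠ 0) (hq : ‖q‖ < 1) {r B : ℕ} (m : ℕ) (hm : m ≤ r) :
    ∀ L ≤ B, agFinite q m r L = ∑ j ∈ Icc (-(B : ℤ) - 1) B,
      signedTri q j * q ^ ((m + 1) * (j ^ 2 + j)) * baileyKernel q 1 L j := by
  induction m with
  | zero =>
    intro L hL
    have h := bailey_step hq0 hq le_rfl (Icc (-(B : ℤ) - 1) B) (signedTri q)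
      (fun s => if s = 0 then 1 else 0) L fun s hs => by
        rw [sum_baileyKernel_one_eq_sum_baileyKernel_zero hq0 hq B s _ (signedTri_reflect hq0),
          sum_signedTri_mul_baileyKernel hq0 hq (hs.trans hL)]
    rw [sum_range_succ'] at h
    simpa [agFinite_zero] using h
  | succ m ih =>
    intro L hL
    have h := bailey_step hq0 hq le_rfl _ _ (agFinite q m r) L
      fun s hs => ih (by lia) s (hs.trans hL)
    have hpow : ∀ j : ℤ, q ^ (((m + 1 : ℕ) + 1) * (j ^ 2 + j)) =
        q ^ ((m + 1) * (j ^ 2 + j)) * q ^ (j ^ 2 + ((1 : ℕ) : ℤ) * j) := fun j => by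
      rw [← zpow_add₀ hq0]
      congr 1
      push_cast
      ring
    simp_rw [hpow, ← mul_assoc]
    rw [← h, agFinite]
    refine sum_congr rfl fun s _ => ?_
    rw [agFiber_succ, if_pos hm, ← zpow_natCast]
    push_cast
    simp

/-- The outer part of the Bailey chain, relative to `1`. -/
lemma agFinite_add {q : ℂ} (hq0 : q ≠ 0) (hq : ‖q‖ < 1) {r B : ℕ} (p : ℕ) :
    ∀ L ≤ B, agFinite q (r + p) r L = ∑ j ∈ Icc (-(B : ℤ) - 1) B,
      signedTri q j * q ^ ((r + 1) * (j ^ 2 + j) + p * j ^ 2) * baileyKernel q 0 L j := by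
  induction p with
  | zero =>
    intro L hL
    rw [add_zero, agFinite_of_le hq0 hq r le_rfl L hL,
      sum_baileyKernel_one_eq_sum_baileyKernel_zero hq0 hq]
    · simp
    · intro j
      rw [signedTri_reflect hq0, show (-1 - j) ^ 2 + (-1 - j) = j ^ 2 + j by ring]
      ring
  | succ p ih =>
    intro L hL
    have h := bailey_step hq0 hq zero_le_one _ _ (agFinite q (r + p) r) L
      fun s hs => ih s (hs.trans hL)
    have hpow : ∀ j : ℤ, q ^ (((r : ℤ) + 1) * (j ^ 2 + j) + ((p + 1 : ℕ) : ℤ) * j ^ 2) =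
        q ^ (((r : ℤ) + 1) * (j ^ 2 + j) + p * j ^ 2) * q ^ (j ^ 2 + ((0 : ℕ) : ℤ) * j) :=
      fun j => by
        rw [← zpow_add₀ hq0]
        congr 1
        push_cast
        ring
    simp_rw [hpow, ← mul_assoc]
    rw [← h, ← add_assoc, agFinite]
    refine sum_congr rfl fun s _ => ?_
    rw [agFiber_succ, if_neg (by lia), ← zpow_natCast]
    push_cast
    simp

lemma summable_prod_pow {x : ℝ} (hx0 : 0 ≤ x) (hx : x < 1) (m : ℕ) :
    Summable fun n : Fin m → ℕ => x ^ ∑ j, n j := by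
  induction m with
  | zero => exact Summable.of_finite
  | succ m ih =>
    rw [← (Fin.consEquiv fun _ => ℕ).summable_iff]
    refine ((summable_geometric_of_lt_one hx0 hx).mul_of_nonneg ih (fun _ => by positivity)
      (fun _ => by positivity)).congr fun p => ?_
    simp [Fin.consEquiv, Fin.sum_cons, pow_add]

lemma exists_norm_agSummand_le {q : ℂ} (hq : ‖q‖ < 1) (m r : ℕ) :
    ∃ C : ℝ, ∀ n, ‖agSummand q m r n‖ ≤ C * ‖q‖ ^ ∑ j, n j := by
  obtain ⟨C, hC0, hC⟩ := exists_norm_invQPoch_le hq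
  refine ⟨C ^ m, fun n => ?_⟩
  rw [agSummand, norm_mul, norm_pow, mul_comm, norm_prod]
  refine mul_le_mul ?_ ?_ (by positivity) (by positivity)
  · calc ∏ j, ‖invQPoch q (n j)‖ ≤ ∏ _j : Fin m, C := prod_le_prod (by simp) fun j _ => hC _
      _ = C ^ m := by simp
  · refine pow_le_pow_of_le_one (norm_nonneg q) hq.le ?_
    cases m with
    | zero => simp
    | succ m =>
      rw [sum_range_succ', ← Nsum_one]
      have h := Nat.le_self_pow two_ne_zero (Nsum (m + 1) n 1)
      simp only [zero_add]
      lia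

lemma summable_norm_agSummand {q : ℂ} (hq : ‖q‖ < 1) (m r : ℕ) :
    Summable fun n => ‖agSummand q m r n‖ := by
  obtain ⟨C, hC⟩ := exists_norm_agSummand_le hq m r
  exact ((summable_prod_pow (norm_nonneg q) hq m).mul_left C).of_nonneg_of_le
    (fun _ => norm_nonneg _) hC

lemma summable_and_tsum_agFiber {q : ℂ} (hq : ‖q‖ < 1) (m r : ℕ) :
    Summable (fun s => ‖agFiber q m r s‖) ∧
      ∑' s, agFiber q m r s = ∑' n, agSummand q m r n := by
  have hs := summable_norm_agSummand hq m r
  have hs' := (Finset.Nat.sigmaAntidiagonalTupleEquivTuple m).summable_iff.mpr hs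
  constructor
  · refine hs'.sigma.of_nonneg_of_le (fun _ => norm_nonneg _) fun s => ?_
    rw [tsum_fintype, agFiber]
    refine (norm_sum_le _ _).trans_eq ?_
    rw [← sum_coe_sort]
    rfl
  · rw [← (Finset.Nat.sigmaAntidiagonalTupleEquivTuple m).tsum_eq, Summable.tsum_sigma]
    · refine tsum_congr fun s => ?_
      rw [tsum_fintype, agFiber, ← sum_coe_sort]
      rfl
    · exact Summable.of_norm hs'

lemma tendsto_agFinite {q : ℂ} (hq : ‖q‖ < 1) (m r : ℕ) :
    Tendsto (agFinite q m r) atTop (𝓝 ((∑' n, agSummand q m r n) * (qPochInf q q)⁻¹)) := by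
  obtain ⟨hs, htsum⟩ := summable_and_tsum_agFiber hq m r
  obtain ⟨C, hC0, hC⟩ := exists_norm_invQPoch_le hq
  have hfin : agFinite q m r = fun L : ℕ => ∑' s : ℕ, agFiber q m r s * invQPoch q (L - s) := by
    funext L
    refine (tsum_eq_sum fun s hs => ?_).symm
    rw [invQPoch_of_neg q (by simp at hs; lia), mul_zero]
  rw [hfin, ← htsum, ← tsum_mul_right]
  refine tendsto_tsum_of_dominated_convergence (bound := fun s => ‖agFiber q m r s‖ * C)
    (hs.mul_right _) (fun s => ?_) (Eventually.of_forall fun L s => ?_)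
  · exact ((tendsto_invQPoch hq).comp (tendsto_atTop_add_const_right _ (-(s : ℤ))
      tendsto_natCast_atTop_atTop)).const_mul _
  · rw [norm_mul]
    gcongr
    exact hC _

lemma tsum_agSummand {q : ℂ} (hq0 : q ≠ 0) (hq : ‖q‖ < 1) (r p : ℕ)
    (hsum : Summable fun j : ℤ =>
      ‖signedTri q j * q ^ ((r + 1) * (j ^ 2 + j) + p * j ^ 2)‖) :
    ∑' n, agSummand q (r + p) r n =
      (∑' j : ℤ, signedTri q j * q ^ ((r + 1) * (j ^ 2 + j) + p * j ^ 2)) / qPochInf q q := by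
  have h := tendsto_nhds_unique (tendsto_agFinite hq (r + p) r)
    ((tendsto_tsum_baileyKernel hq _ hsum).congr fun L => by
      rw [agFinite_add hq0 hq p L le_rfl, sum_Icc_eq_tsum q _ le_rfl])
  have hne := qPochInf_self_ne_zero hq
  rw [← mul_assoc] at h
  rw [div_eq_mul_inv]
  exact mul_right_cancel₀ (inv_ne_zero hne) h

lemma summable_norm_of_le_pow_natAbs {x : ℝ} (hx0 : 0 ≤ x) (hx : x < 1) {f : ℤ → ℂ}
    (hf : ∀ j, ‖f j‖ ≤ x ^ j.natAbs) : Summable fun j => ‖f j‖ := by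
  refine Summable.of_nonneg_of_le (fun _ => norm_nonneg _) hf ?_
  have hg := summable_geometric_of_lt_one hx0 hx
  exact Summable.of_nat_of_neg (by simpa using hg) (by simpa using hg)

lemma agTerm_eq_agSummand {k a : ℕ} (hk : 2 ≤ k) (ha : 1 ≤ a) (hak : a ≤ k) (q : ℂ)
    (n : Fin (k - 1) → ℕ) : agTerm k a q n = agSummand q (k - 1) (k - a) n := by
  rw [agTerm, agSummand, div_eq_mul_inv, ← prod_inv_distrib]
  simp only [invQPoch_natCast]
  congr 2
  rw [sum_add_distrib]
  congr 1
  · rw [range_eq_Ico, sum_Ico_add' (fun i => Nsum (k - 1) n i ^ 2) 0 (k - 1) 1]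
    rfl
  · rw [← sum_filter]
    refine sum_nbij' (fun i => i - 1) (fun i => i + 1) ?_ ?_ ?_ ?_ ?_ <;> intro i hi <;>
      simp only [mem_Icc, mem_filter, mem_range] at * <;> try lia
    rw [Nat.sub_add_cancel (by lia)]

lemma signedTri_mul_zpow_eq {q : ℂ} (hq0 : q ≠ 0) {k a : ℕ} (ha : 1 ≤ a) (hak : a ≤ k) (j : ℤ) :
    signedTri q j * q ^ (((k - a : ℕ) + 1) * (j ^ 2 + j) + (a - 1 : ℕ) * j ^ 2) =
      signedTri (q ^ (2 * k + 1)) j * (q ^ (2 * k + 1 - a)) ^ j := by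
  have h2 : 2 * (j * (j - 1) / 2) = j * (j - 1) :=
    Int.mul_ediv_cancel' (Int.even_mul_pred_self j).two_dvd
  rw [signedTri, signedTri, mul_assoc, mul_assoc, ← zpow_natCast q, ← zpow_natCast q, ← zpow_mul,
    ← zpow_mul, ← zpow_add₀ hq0, ← zpow_add₀ hq0]
  congr 2
  push_cast [Nat.cast_sub hak, Nat.cast_sub ha, Nat.cast_sub (show a ≤ 2 * k + 1 by lia)]
  linear_combination (-(k : ℤ)) * h2

lemma norm_signedTri_mul_zpow_le {q : ℂ} (hq0 : q ≠ 0) (hq : ‖q‖ < 1) {k a : ℕ} (ha : 1 ≤ a)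
    (hak : a ≤ k) (j : ℤ) :
    ‖signedTri (q ^ (2 * k + 1)) j * (q ^ (2 * k + 1 - a)) ^ j‖ ≤ ‖q‖ ^ j.natAbs := by
  have h2 : 2 * (j * (j - 1) / 2) = j * (j - 1) :=
    Int.mul_ediv_cancel' (Int.even_mul_pred_self j).two_dvd
  rw [signedTri, mul_assoc, norm_mul, norm_zpow, norm_neg, norm_one, one_zpow, one_mul,
    ← zpow_natCast q, ← zpow_natCast q, ← zpow_mul, ← zpow_mul, ← zpow_add₀ hq0, norm_zpow,
    ← zpow_natCast]
  refine zpow_le_zpow_right_of_le_one₀ (norm_pos_iff.mpr hq0) hq.le ?_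
  rw [Int.natCast_natAbs]
  push_cast [Nat.cast_sub (show a ≤ 2 * k + 1 by lia)]
  generalize j * (j - 1) / 2 = h at *
  have ha' : (1 : ℤ) ≤ a := by exact_mod_cast ha
  have hak' : (a : ℤ) ≤ k := by exact_mod_cast hak
  rcases le_total 0 j with hj | hj
  · rw [abs_of_nonneg hj]
    have hh : 0 ≤ h := by
      rcases hj.eq_or_lt with rfl | hj'
      · lia
      · nlinarith
    nlinarith [mul_nonneg (show (0 : ℤ) ≤ 2 * k + 1 by lia) hh,
      mul_nonneg (show (0 : ℤ) ≤ 2 * k - a by lia) hj]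
  · rw [abs_of_nonpos hj]
    have hh : 0 ≤ h + j := by
      rcases hj.eq_or_lt with rfl | hj'
      · lia
      · nlinarith
    nlinarith [mul_nonneg (show (0 : ℤ) ≤ 2 * k + 1 by lia) hh,
      mul_nonneg (show (0 : ℤ) ≤ a - 1 by lia) (neg_nonneg.mpr hj)]

lemma qPochInf_zero (q : ℂ) : qPochInf q 0 = 1 := by
  simp [qPochInf]

lemma agSummand_zero_left (m r : ℕ) {n : Fin m → ℕ} (hn : n ≠ 0) : agSummand 0 m r n = 0 := by
  cases m with
  | zero => exact absurd (Subsingleton.elim _ _) hn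
  | succ m =>
    rw [agSummand, zero_pow, zero_mul]
    intro h
    rw [sum_range_succ'] at h
    have h1 : Nsum (m + 1) n 1 = 0 := by
      have h' : Nsum (m + 1) n (0 + 1) ^ 2 = 0 := by lia
      simpa using h'
    rw [Nsum_one, sum_eq_zero_iff] at h1
    exact hn (funext fun j => h1 j (mem_univ j))

lemma tsum_agSummand_zero (m r : ℕ) : ∑' n, agSummand 0 m r n = 1 := by
  rw [tsum_eq_single 0 fun n hn => agSummand_zero_left m r hn]
  simp [agSummand, Nsum, invQPoch_zero]

/-- The Andrews–Gordon identity. -/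
theorem andrews_gordon (k a : ℕ) (hk : 2 ≤ k) (ha : 1 ≤ a) (hak : a ≤ k)
    (q : ℂ) (hq : ‖q‖ < 1) :
    Summable (agTerm k a q) ∧
    ∑' n : Fin (k - 1) → ℕ, agTerm k a q n =
      qPochInf (q ^ (2 * k + 1)) (q ^ a) *
        qPochInf (q ^ (2 * k + 1)) (q ^ (2 * k + 1 - a)) *
        qPochInf (q ^ (2 * k + 1)) (q ^ (2 * k + 1)) / qPochInf q q := by
  rw [funext (agTerm_eq_agSummand hk ha hak q)]
  refine ⟨(summable_norm_agSummand hq _ _).of_norm, ?_⟩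
  rcases eq_or_ne q 0 with rfl | hq0
  · rw [tsum_agSummand_zero, zero_pow (by lia : a ≠ 0), zero_pow (by lia : 2 * k + 1 - a ≠ 0),
      zero_pow (by lia : 2 * k + 1 ≠ 0), qPochInf_zero]
    simp
  · have hQ : ‖q ^ (2 * k + 1)‖ < 1 := by
      rw [norm_pow]
      exact pow_lt_one₀ (norm_nonneg q) hq (by lia)
    have hsum := summable_norm_of_le_pow_natAbs (norm_nonneg q) hq
      (norm_signedTri_mul_zpow_le hq0 hq ha hak)
    have h := tsum_agSummand hq0 hq (k - a) (a - 1)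
      (by simpa only [signedTri_mul_zpow_eq hq0 ha hak] using hsum)
    rw [show k - a + (a - 1) = k - 1 by lia] at h
    have hdiv : q ^ (2 * k + 1) / q ^ (2 * k + 1 - a) = q ^ a := by
      rw [div_eq_iff (pow_ne_zero _ hq0), ← pow_add]
      congr 1
      lia
    rw [h, tsum_congr (signedTri_mul_zpow_eq hq0 ha hak),
      tsum_signedTri_mul_zpow (pow_ne_zero _ hq0) hQ (pow_ne_zero _ hq0) hsum, hdiv]
    ring
end
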